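/- Let v be a positive, non-constant solution of the ODE (O6). If v has a local maximum at t₀ ∈ ℝ, then v(t₀) > a*_n; if v has a local minimum at t₀ ∈ ℝ, then v(t₀) < a*_n. -/

import Mathlib

noncomputable section

open Real

def cN (n : ℕ) : ℝ := (n : ℝ) * ((n : ℝ) - 6) * ((n : ℝ) ^ 4 - 20 * (n : ℝ) ^ 2 + 64) / 64
def K0 (n : ℕ) : ℝ := ((n : ℝ) - 6) ^ 2 * ((n : ℝ) - 2) ^ 2 * ((n : ℝ) + 2) ^ 2 / 64
def K2 (n : ℕ) : ℝ := (3 * (n : ℝ) ^ 4 - 24 * (n : ℝ) ^ 3 + 72 * (n : ℝ) ^ 2 - 96 * (n : ℝ) + 304) / 16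
def K4 (n : ℕ) : ℝ := (3 * (n : ℝ) ^ 2 - 12 * (n : ℝ) + 44) / 4

/-- `v` is a (classical, entire) solution of the sixth order ODE (O6). -/
def IsSolO6 (n : ℕ) (v : ℝ → ℝ) : Prop :=
  ContDiff ℝ 6 v ∧ ∀ t : ℝ,
    iteratedDeriv 6 v t - K4 n * iteratedDeriv 4 v t + K2 n * iteratedDeriv 2 v t
      - K0 n * v t + cN n * |v t| ^ (12 / ((n : ℝ) - 6)) * v t = 0

def aStar (n : ℕ) : ℝ := (K0 n / cN n) ^ (((n : ℝ) - 6) / 12)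

/-- `f 0, f 1, …, f m` are successive derivatives of one function on the line. -/
def IsJet (m : ℕ) (f : ℕ → ℝ → ℝ) : Prop :=
  ∀ k < m, ∀ t, HasDerivAt (f k) (f (k + 1) t) t

lemma IsJet.mono {m m' : ℕ} {f : ℕ → ℝ → ℝ} (h : IsJet m f) (hm : m' ≤ m) : IsJet m' f :=
  fun k hk => h k (hk.trans_le hm)

lemma IsJet.continuous {m k : ℕ} {f : ℕ → ℝ → ℝ} (h : IsJet m f) (hk : k < m) :
    Continuous (f k) :=
  continuous_iff_continuousAt.2 fun t => (h k hk t).continuousAt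

lemma IsJet.neg {m : ℕ} {f : ℕ → ℝ → ℝ} (h : IsJet m f) : IsJet m (fun k t => -f k t) :=
  fun k hk t => (h k hk t).neg

lemma IsJet.comp_neg {m : ℕ} {f : ℕ → ℝ → ℝ} (h : IsJet m f) :
    IsJet m (fun k t => (-1) ^ k * f k (-t)) := by
  intro k hk t
  have h1 := ((h k hk (-t)).comp t (hasDerivAt_neg t)).const_mul ((-1 : ℝ) ^ k)
  refine h1.congr_deriv ?_
  ring

lemma IsJet.comp_const_add {m : ℕ} {f : ℕ → ℝ → ℝ} (h : IsJet m f) (s : ℝ) :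
    IsJet m (fun k t => f k (s + t)) := by
  intro k hk t
  have h1 := (h k hk (s + t)).comp t ((hasDerivAt_id t).const_add s)
  exact h1.congr_deriv (by simp)

lemma IsJet.sub {m : ℕ} {f g : ℕ → ℝ → ℝ} (hf : IsJet m f) (hg : IsJet m g) :
    IsJet m (fun k t => f k t - g k t) :=
  fun k hk t => (hf k hk t).sub (hg k hk t)

lemma isJet_const (m : ℕ) (c : ℝ) : IsJet m (fun k _ => if k = 0 then c else 0) :=
  fun _ _ t => by simpa using hasDerivAt_const t _

lemma le_of_hasDerivAt_nonneg {g g' : ℝ → ℝ} {s t : ℝ} (hg : ∀ x, HasDerivAt g (g' x) x)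
    (hst : s ≤ t) (h : ∀ x ∈ Set.Icc s t, 0 ≤ g' x) : g s ≤ g t := by
  refine monotoneOn_of_deriv_nonneg (convex_Icc s t)
    (fun x _ => (hg x).continuousAt.continuousWithinAt)
    (fun x _ => (hg x).differentiableAt.differentiableWithinAt) ?_
    (Set.left_mem_Icc.2 hst) (Set.right_mem_Icc.2 hst) hst
  intro x hx
  rw [(hg x).deriv]
  exact h x (interior_subset hx)

lemma lt_of_hasDerivAt_pos {g g' : ℝ → ℝ} {s t : ℝ} (hg : ∀ x, HasDerivAt g (g' x) x)
    (hst : s < t) (h : ∀ x ∈ Set.Ioc s t, 0 < g' x) : g s < g t := by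
  refine strictMonoOn_of_deriv_pos (convex_Icc s t)
    (fun x _ => (hg x).continuousAt.continuousWithinAt) ?_
    (Set.left_mem_Icc.2 hst.le) (Set.right_mem_Icc.2 hst.le) hst
  intro x hx
  rw [(hg x).deriv]
  rw [interior_Icc] at hx
  exact h x ⟨hx.1, hx.2.le⟩

lemma hasDerivAt_exp_mul (l x : ℝ) : HasDerivAt (fun t => exp (l * t)) (l * exp (l * x)) x := by
  simpa [mul_comm] using ((hasDerivAt_id x).const_mul l).exp

lemma nonneg_of_sq_mul_le_deriv2 {l s T : ℝ} {f : ℕ → ℝ → ℝ} (hl : 0 < l) (hf : IsJet 2 f)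
    (h : ∀ t ∈ Set.Icc s T, l ^ 2 * f 0 t ≤ f 2 t) (h0 : f 0 s = 0) (h1 : f 1 s = 0) :
    ∀ t ∈ Set.Icc s T, 0 ≤ f 0 t ∧ 0 ≤ f 1 t := by
  have A : ∀ t ∈ Set.Icc s T, 0 ≤ f 1 t + l * f 0 t := by
    intro t ht
    have := le_of_hasDerivAt_nonneg
      (g := fun t => exp (-l * t) * (f 1 t + l * f 0 t))
      (fun x => (hasDerivAt_exp_mul (-l) x).mul
        ((hf 1 (by norm_num) x).add ((hf 0 (by norm_num) x).const_mul l))) ht.1 ?_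
    · simp only [h0, h1, mul_zero, add_zero] at this
      exact nonneg_of_mul_nonneg_right this (exp_pos _)
    · intro x hx
      have h2 := h x ⟨hx.1, hx.2.trans ht.2⟩
      have := mul_nonneg (exp_pos (-l * x)).le (sub_nonneg.2 h2)
      simp only [zero_add, Nat.reduceAdd]
      linarith
  have B : ∀ t ∈ Set.Icc s T, 0 ≤ f 1 t - l * f 0 t := by
    intro t ht
    have := le_of_hasDerivAt_nonneg
      (g := fun t => exp (l * t) * (f 1 t - l * f 0 t))
      (fun x => (hasDerivAt_exp_mul l x).mul
        ((hf 1 (by norm_num) x).sub ((hf 0 (by norm_num) x).const_mul l))) ht.1 ?_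
    · simp only [h0, h1, mul_zero, sub_zero] at this
      exact nonneg_of_mul_nonneg_right this (exp_pos _)
    · intro x hx
      have h2 := h x ⟨hx.1, hx.2.trans ht.2⟩
      have := mul_nonneg (exp_pos (l * x)).le (sub_nonneg.2 h2)
      simp only [zero_add, Nat.reduceAdd]
      linarith
  intro t ht
  have C : 0 ≤ f 0 t := by
    have := le_of_hasDerivAt_nonneg
      (g := fun t => exp (l * t) * f 0 t)
      (fun x => (hasDerivAt_exp_mul l x).mul (hf 0 (by norm_num) x)) ht.1 ?_
    · simp only [h0, mul_zero] at this
      exact nonneg_of_mul_nonneg_right this (exp_pos _)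
    · intro x hx
      have := mul_nonneg (exp_pos (l * x)).le (A x ⟨hx.1, hx.2.trans ht.2⟩)
      simp only [zero_add]
      linarith
  exact ⟨C, by nlinarith [B t ht]⟩

/-- The jet of the solution of `D² f = l² f` with value `x` and derivative `y` at `s`. -/
def hyperbolicJet (l s x y : ℝ) : ℕ → ℝ → ℝ
  | 0, t => x * cosh (l * (t - s)) + y * (sinh (l * (t - s)) / l)
  | 1, t => x * (l * sinh (l * (t - s))) + y * cosh (l * (t - s))
  | _, t => l ^ 2 * (x * cosh (l * (t - s)) + y * (sinh (l * (t - s)) / l))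

lemma isJet_hyperbolicJet {l : ℝ} (hl : 0 < l) (s x y : ℝ) :
    IsJet 2 (hyperbolicJet l s x y) := by
  have e : ∀ t, HasDerivAt (fun t => l * (t - s)) l t := fun t => by
    simpa using ((hasDerivAt_id t).sub_const s).const_mul l
  have hc := fun t => (e t).cosh
  have hs := fun t => (e t).sinh
  intro k hk t
  interval_cases k
  · refine (((hc t).const_mul x).add (((hs t).div_const l).const_mul y)).congr_deriv ?_
    simp only [hyperbolicJet]
    field_simp
  · refine ((((hs t).const_mul l).const_mul x).add ((hc t).const_mul y)).congr_deriv ?_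
    simp only [hyperbolicJet]
    field_simp

lemma hyperbolicJet_le {l s T : ℝ} {f : ℕ → ℝ → ℝ} (hl : 0 < l) (hf : IsJet 2 f)
    (h : ∀ t ∈ Set.Icc s T, l ^ 2 * f 0 t ≤ f 2 t) :
    ∀ t ∈ Set.Icc s T,
      f 0 s * cosh (l * (t - s)) + f 1 s * (sinh (l * (t - s)) / l) ≤ f 0 t ∧
      f 0 s * (l * sinh (l * (t - s))) + f 1 s * cosh (l * (t - s)) ≤ f 1 t := by
  intro t ht
  have := nonneg_of_sq_mul_le_deriv2 hl
    (hf.sub (isJet_hyperbolicJet hl s (f 0 s) (f 1 s)))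
    (fun t ht => by have := h t ht; simp only [hyperbolicJet] at *; linarith)
    (by simp [hyperbolicJet]) (by simp [hyperbolicJet]) t ht
  simp only [hyperbolicJet] at this
  exact ⟨by linarith [this.1], by linarith [this.2]⟩

lemma pos_of_sq_mul_lt_deriv2 {l s T : ℝ} {f : ℕ → ℝ → ℝ} (hl : 0 < l) (hf : IsJet 2 f)
    (h : ∀ t ∈ Set.Ioc s T, l ^ 2 * f 0 t < f 2 t) (h0 : f 0 s = 0) (h1 : 0 ≤ f 1 s)
    (h2 : l ^ 2 * f 0 s ≤ f 2 s) :
    ∀ t ∈ Set.Ioc s T, 0 < f 0 t ∧ 0 < f 1 t := by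
  have h' : ∀ t ∈ Set.Icc s T, l ^ 2 * f 0 t ≤ f 2 t := by
    intro t ht
    rcases ht.1.eq_or_lt with rfl | h3
    · exact h2
    · exact (h t ⟨h3, ht.2⟩).le
  have A : ∀ t ∈ Set.Icc s T, 0 ≤ f 0 t := by
    intro t ht
    have h3 := (hyperbolicJet_le hl hf h' t ht).1
    have h4 : 0 ≤ sinh (l * (t - s)) :=
      sinh_nonneg_iff.2 (mul_nonneg hl.le (sub_nonneg.2 ht.1))
    rw [h0] at h3
    have : 0 ≤ f 1 s * (sinh (l * (t - s)) / l) := by positivity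
    linarith
  have B : ∀ t ∈ Set.Ioc s T, 0 < f 1 t := by
    intro t ht
    refine h1.trans_lt (lt_of_hasDerivAt_pos (hf 1 (by norm_num)) ht.1 ?_)
    intro x hx
    have := h x ⟨hx.1, hx.2.trans ht.2⟩
    have h5 := mul_nonneg (sq_nonneg l) (A x ⟨hx.1.le, hx.2.trans ht.2⟩)
    exact h5.trans_lt this
  intro t ht
  refine ⟨?_, B t ht⟩
  rw [← h0]
  exact lt_of_hasDerivAt_pos (hf 0 (by norm_num)) ht.1 fun x hx => B x ⟨hx.1, hx.2.trans ht.2⟩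

lemma half_mul_exp_le {l s : ℝ} {f : ℕ → ℝ → ℝ} (hl : 0 < l) (hf : IsJet 2 f)
    (h : ∀ t, s ≤ t → l ^ 2 * f 0 t ≤ f 2 t) (h0 : 0 ≤ f 0 s) (h1 : 0 ≤ f 1 s)
    {t : ℝ} (ht : s ≤ t) : f 0 s / 2 * exp (l * (t - s)) ≤ f 0 t := by
  have h2 := (hyperbolicJet_le hl hf (fun x hx => h x hx.1) t ⟨ht, le_rfl⟩).1
  have h4 : 0 ≤ sinh (l * (t - s)) :=
    sinh_nonneg_iff.2 (mul_nonneg hl.le (sub_nonneg.2 ht))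
  have : 0 ≤ f 1 s * (sinh (l * (t - s)) / l) := by positivity
  have h5 : exp (l * (t - s)) / 2 ≤ cosh (l * (t - s)) := by
    rw [cosh_eq]
    have := exp_pos (-(l * (t - s)))
    linarith
  nlinarith

lemma eventually_const_mul_exp_le {l m d : ℝ} (hlm : l < m) (hd : 0 < d) (C : ℝ) :
    ∀ᶠ t in Filter.atTop, C * exp (l * t) ≤ d * exp (m * t) := by
  have h1 : Filter.Tendsto (fun t : ℝ => exp ((m - l) * t)) Filter.atTop Filter.atTop :=
    tendsto_exp_atTop.comp (Filter.tendsto_id.const_mul_atTop (sub_pos.2 hlm))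
  filter_upwards [h1.eventually_ge_atTop (C / d)] with t ht
  have h2 : exp (m * t) = exp ((m - l) * t) * exp (l * t) := by
    rw [← exp_add]; ring_nf
  rw [h2, ← mul_assoc]
  refine mul_le_mul_of_nonneg_right ?_ (exp_pos _).le
  rw [div_le_iff₀ hd] at ht
  linarith

lemma eventually_exp_le_of_forced {l m d s : ℝ} {f : ℕ → ℝ → ℝ} (hl : 0 < l) (hlm : l < m)
    (hd : 0 < d) (hf : IsJet 2 f) (h : ∀ t, s ≤ t → l ^ 2 * f 0 t + d * exp (m * t) ≤ f 2 t) :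
    ∃ d' > 0, ∀ᶠ t in Filter.atTop, d' * exp (m * t) ≤ f 0 t := by
  have hml : 0 < m ^ 2 - l ^ 2 := by nlinarith
  obtain ⟨e, he⟩ : ∃ e, e = d / (m ^ 2 - l ^ 2) := ⟨_, rfl⟩
  have he0 : 0 < e := he ▸ div_pos hd hml
  have hed : e * (m ^ 2 - l ^ 2) = d := by rw [he]; field_simp
  have hg : IsJet 2 (fun k t => f k t - e * (m ^ k * exp (m * t))) := by
    refine hf.sub fun k _ t => ?_
    refine (((hasDerivAt_exp_mul m t).const_mul (m ^ k)).const_mul e).congr_deriv ?_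
    ring
  obtain ⟨x, hx⟩ : ∃ x, x = f 0 s - e * (m ^ 0 * exp (m * s)) := ⟨_, rfl⟩
  obtain ⟨y, hy⟩ : ∃ y, y = f 1 s - e * (m ^ 1 * exp (m * s)) := ⟨_, rfl⟩
  refine ⟨e / 2, by positivity, ?_⟩
  filter_upwards [eventually_const_mul_exp_le hlm (half_pos he0)
    ((|x| + |y| / l) * exp (-l * s)), Filter.eventually_ge_atTop s] with t ht hst
  have h2 := (hyperbolicJet_le hl hg (fun u hu => by
    have := h u hu.1
    rw [← hed] at this
    nlinarith) t ⟨hst, le_rfl⟩).1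
  simp only [pow_zero, one_mul] at h2 hx
  rw [← hx, ← hy] at h2
  have hE : exp (-l * s) * exp (l * t) = exp (l * (t - s)) := by
    rw [← exp_add]; ring_nf
  rw [mul_assoc, hE] at ht
  obtain ⟨u, hu⟩ : ∃ u, u = l * (t - s) := ⟨_, rfl⟩
  rw [← hu] at ht h2
  have hu0 : 0 ≤ u := hu ▸ mul_nonneg hl.le (sub_nonneg.2 hst)
  have hc : cosh u ≤ exp u := by
    rw [cosh_eq]
    have : exp (-u) ≤ exp u := exp_le_exp.2 (by linarith)
    linarith
  have hsn : sinh u ≤ exp u := by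
    rw [sinh_eq]
    have := exp_pos (-u)
    have := exp_pos u
    linarith
  have hs0 : 0 ≤ sinh u := sinh_nonneg_iff.2 hu0
  have k1 : -(|x| * exp u) ≤ x * cosh u := by
    have := mul_le_mul_of_nonneg_left hc (abs_nonneg x)
    have := mul_le_mul_of_nonneg_right (neg_abs_le x) (cosh_pos u).le
    linarith
  have k2 : -(|y| / l * exp u) ≤ y * (sinh u / l) := by
    have h7 := mul_le_mul_of_nonneg_left hsn (abs_nonneg y)
    have h8 := mul_le_mul_of_nonneg_right (neg_abs_le y) hs0
    have h9 : (-(|y| * exp u)) / l ≤ (y * sinh u) / l :=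
      div_le_div_of_nonneg_right (by linarith) hl.le
    calc -(|y| / l * exp u) = (-(|y| * exp u)) / l := by ring
      _ ≤ _ := h9
      _ = _ := by ring
  linarith

lemma abs_deriv_le_of_nonneg {l : ℝ} {f : ℕ → ℝ → ℝ} (hl : 0 < l) (hf : IsJet 2 f)
    (h0 : ∀ t, 0 ≤ f 0 t) (h : ∀ t, f 2 t ≤ l ^ 2 * f 0 t) (t : ℝ) :
    |f 1 t| ≤ l * f 0 t := by
  have key : ∀ {g : ℕ → ℝ → ℝ}, IsJet 2 g → (∀ t, 0 ≤ g 0 t) → (∀ t, g 2 t ≤ l ^ 2 * g 0 t) →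
      ∀ s, -(l * g 0 s) ≤ g 1 s := by
    intro g hg hg0 hg2 s
    by_contra! hs
    obtain ⟨e, he⟩ : ∃ e, e = -(g 0 s + g 1 s / l) := ⟨_, rfl⟩
    have he0 : 0 < e := by
      rw [he]
      have : g 1 s / l < -g 0 s := by rw [div_lt_iff₀ hl]; linarith
      linarith
    obtain ⟨C, hC⟩ : ∃ C, C = |g 0 s - g 1 s / l| := ⟨_, rfl⟩
    have hC0 : 0 ≤ C := hC ▸ abs_nonneg _
    have hu : 0 ≤ (C + 1) / e := by positivity
    obtain ⟨u, hu'⟩ : ∃ u, u = (C + 1) / e := ⟨_, rfl⟩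
    rw [← hu'] at hu
    have h3 := (hyperbolicJet_le hl hg.neg (s := s) (T := s + u / l)
      (fun t _ => by have := hg2 t; linarith) (s + u / l)
      ⟨by have := div_nonneg hu hl.le; linarith, le_rfl⟩).1
    have h4 : l * (s + u / l - s) = u := by field_simp; ring
    rw [h4, cosh_eq, sinh_eq] at h3
    have h5 := hg0 (s + u / l)
    have h6 : u + 1 ≤ exp u := add_one_le_exp u
    have h7 : exp (-u) ≤ 1 := exp_le_one_iff.2 (by linarith)
    have h8 : e * u = C + 1 := by rw [hu']; field_simp
    have h9 : (g 0 s - g 1 s / l) * exp (-u) ≤ C := by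
      have := mul_le_mul_of_nonneg_right (le_abs_self (g 0 s - g 1 s / l)) (exp_pos (-u)).le
      rw [← hC] at this
      nlinarith
    have h10 : -(g 0 s) * ((exp u + exp (-u)) / 2) + -(g 1 s) * ((exp u - exp (-u)) / 2 / l)
      = (e * exp u - (g 0 s - g 1 s / l) * exp (-u)) / 2 := by rw [he]; ring
    nlinarith
  rw [abs_le]
  refine ⟨key hf h0 h t, ?_⟩
  have := key (hf.comp_neg) (fun s => by simpa using h0 (-s))
    (fun s => by simpa using h (-s)) (-t)
  simp only [neg_neg, pow_zero, pow_one, one_mul] at this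
  linarith

lemma nonpos_of_bounded_of_sq_mul_le_deriv2 {l M : ℝ} {f : ℕ → ℝ → ℝ} (hl : 0 < l)
    (hf : IsJet 2 f) (hM : ∀ t, f 0 t ≤ M) (h : ∀ t, l ^ 2 * f 0 t ≤ f 2 t) (t : ℝ) :
    f 0 t ≤ 0 := by
  have key : ∀ {g : ℕ → ℝ → ℝ}, IsJet 2 g → (∀ t, g 0 t ≤ M) → (∀ t, l ^ 2 * g 0 t ≤ g 2 t) →
      ∀ s, 0 ≤ g 1 s → g 0 s ≤ 0 := by
    intro g hg hgM hg2 s hs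
    by_contra! h0
    have h1 := eventually_const_mul_exp_le hl (d := g 0 s / 2 * exp (-l * s))
      (by positivity) (M + 1)
    obtain ⟨u, hu, hsu⟩ := (h1.and (Filter.eventually_ge_atTop s)).exists
    have h2 := half_mul_exp_le hl hg (fun t _ => hg2 t) h0.le hs hsu
    have h3 : exp (-l * s) * exp (l * u) = exp (l * (u - s)) := by
      rw [← exp_add]; ring_nf
    rw [zero_mul, exp_zero, mul_assoc, h3] at hu
    linarith [hgM u]
  rcases le_total 0 (f 1 t) with h1 | h1
  · exact key hf hM h t h1
  · simpa using key (hf.comp_neg) (fun s => by simpa using hM (-s))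
      (fun s => by simpa using h (-s)) (-t) (by simpa using h1)

/-- The jet of `c * f` minus the second derivative of `f`. -/
def helmholtz (c : ℝ) (f : ℕ → ℝ → ℝ) : ℕ → ℝ → ℝ := fun k t => c * f k t - f (k + 2) t

lemma IsJet.helmholtz {m : ℕ} {f : ℕ → ℝ → ℝ} (hf : IsJet (m + 2) f) (c : ℝ) :
    IsJet m (helmholtz c f) :=
  fun k hk t => ((hf k (by omega) t).const_mul c).sub (hf (k + 2) (by omega) t)

/-- The jet of `t ↦ f (-t)`. -/
def reflectJet (f : ℕ → ℝ → ℝ) : ℕ → ℝ → ℝ := fun k t => (-1) ^ k * f k (-t)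

lemma helmholtz_reflectJet (c : ℝ) (f : ℕ → ℝ → ℝ) :
    helmholtz c (reflectJet f) = reflectJet (helmholtz c f) := by
  funext k t
  simp only [helmholtz, reflectJet]
  ring

/-- `v` is the jet of a positive solution of
`(a² - D²) ((a + 2)² - D²) ((a + 4)² - D²) v = κ v ^ (1 + 6 / a)`. -/
structure IsPosSol (a κ : ℝ) (v : ℕ → ℝ → ℝ) : Prop where
  jet : IsJet 6 v
  pos : ∀ t, 0 < v 0 t
  ode : ∀ t, (a + 4) ^ 2 * helmholtz ((a + 2) ^ 2) (helmholtz (a ^ 2) v) 0 t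
    - helmholtz ((a + 2) ^ 2) (helmholtz (a ^ 2) v) 2 t = κ * v 0 t ^ (1 + 6 / a)

namespace IsPosSol

variable {a κ : ℝ} {v : ℕ → ℝ → ℝ}

lemma reflect (h : IsPosSol a κ v) : IsPosSol a κ (reflectJet v) where
  jet := h.jet.comp_neg
  pos t := by simpa [reflectJet] using h.pos (-t)
  ode t := by
    rw [helmholtz_reflectJet, helmholtz_reflectJet]
    simpa [reflectJet] using h.ode (-t)

lemma shift (h : IsPosSol a κ v) (s : ℝ) : IsPosSol a κ (fun k t => v k (s + t)) where
  jet := h.jet.comp_const_add s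
  pos _ := h.pos _
  ode t := h.ode (s + t)

lemma helmholtz_helmholtz_nonneg (ha : 0 < a) (hκ : 0 < κ) (h : IsPosSol a κ v) (t : ℝ) :
    0 ≤ helmholtz ((a + 2) ^ 2) (helmholtz (a ^ 2) v) 0 t := by
  have key : ∀ {v : ℕ → ℝ → ℝ}, IsPosSol a κ v → ∀ s,
      helmholtz ((a + 2) ^ 2) (helmholtz (a ^ 2) v) 0 s < 0 →
      helmholtz ((a + 2) ^ 2) (helmholtz (a ^ 2) v) 1 s ≤ 0 → False := by
    intro v h s hs0 hs1
    obtain ⟨z, hz⟩ : ∃ z, z = helmholtz (a ^ 2) v := ⟨_, rfl⟩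
    obtain ⟨w, hw⟩ : ∃ w, w = helmholtz ((a + 2) ^ 2) z := ⟨_, rfl⟩
    have hode := h.ode
    rw [← hz, ← hw] at hs0 hs1 hode
    have jz : IsJet 4 z := hz ▸ h.jet.helmholtz _
    have jw : IsJet 2 w := hw ▸ jz.helmholtz _
    have g1 : ∀ t, s ≤ t → (a + 2) ^ 2 * z 0 t
        + -w 0 s / 2 * exp (-(a + 4) * s) * exp ((a + 4) * t) ≤ z 2 t := by
      intro t ht
      have h1 := half_mul_exp_le (l := a + 4) (by linarith) jw.neg
        (fun u _ => by
          have := hode u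
          have := mul_pos hκ (rpow_pos_of_pos (h.pos u) (1 + 6 / a))
          linarith) (by linarith) (by linarith) ht
      have h3 : exp (-(a + 4) * s) * exp ((a + 4) * t) = exp ((a + 4) * (t - s)) := by
        rw [← exp_add]; ring_nf
      rw [mul_assoc, h3]
      have h4 : w 0 t = (a + 2) ^ 2 * z 0 t - z 2 t := by rw [hw]; rfl
      linarith
    obtain ⟨d, hd, hdz⟩ := eventually_exp_le_of_forced (l := a + 2) (m := a + 4) (by linarith)
      (by linarith) (mul_pos (by linarith) (exp_pos _)) (jz.mono (by norm_num)) g1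
    obtain ⟨s', hs'⟩ := Filter.eventually_atTop.1 hdz
    obtain ⟨e, he, hev⟩ := eventually_exp_le_of_forced (l := a) (m := a + 4) (s := s') ha
      (by linarith) hd (h.jet.mono (m' := 2) (by norm_num)).neg (fun t ht => by
        have h4 : z 0 t = a ^ 2 * v 0 t - v 2 t := by rw [hz]; rfl
        have := hs' t ht
        linarith)
    obtain ⟨t, ht⟩ := hev.exists
    have := h.pos t
    have := mul_pos he (exp_pos ((a + 4) * t))
    linarith
  by_contra! h0
  rcases le_total (helmholtz ((a + 2) ^ 2) (helmholtz (a ^ 2) v) 1 t) 0 with h1 | h1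
  · exact key h t h0 h1
  · refine key h.reflect (-t) ?_ ?_ <;>
    · rw [helmholtz_reflectJet, helmholtz_reflectJet]
      simpa [reflectJet] using by assumption

lemma helmholtz_nonneg (ha : 0 < a) (hκ : 0 < κ) (h : IsPosSol a κ v) (t : ℝ) :
    0 ≤ helmholtz (a ^ 2) v 0 t := by
  have key : ∀ {v : ℕ → ℝ → ℝ}, IsPosSol a κ v → ∀ s,
      helmholtz (a ^ 2) v 0 s < 0 → helmholtz (a ^ 2) v 1 s ≤ 0 → False := by
    intro v h s hs0 hs1
    obtain ⟨z, hz⟩ : ∃ z, z = helmholtz (a ^ 2) v := ⟨_, rfl⟩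
    obtain ⟨w, hw⟩ : ∃ w, w = helmholtz ((a + 2) ^ 2) z := ⟨_, rfl⟩
    have hode := h.ode
    have hw0 := h.helmholtz_helmholtz_nonneg ha hκ
    rw [← hz] at hs0 hs1 hode hw0
    rw [← hw] at hode hw0
    have jz : IsJet 4 z := hz ▸ h.jet.helmholtz _
    have jw : IsJet 2 w := hw ▸ jz.helmholtz _
    have g1 : ∀ t, s ≤ t → a ^ 2 * v 0 t
        + -z 0 s / 2 * exp (-(a + 2) * s) * exp ((a + 2) * t) ≤ v 2 t := by
      intro t ht
      have h1 := half_mul_exp_le (l := a + 2) (by linarith) (jz.mono (m' := 2) (by norm_num)).neg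
        (fun u _ => by
          have := hw0 u
          have h4 : w 0 u = (a + 2) ^ 2 * z 0 u - z 2 u := by rw [hw]; rfl
          linarith) (by linarith) (by linarith) ht
      have h3 : exp (-(a + 2) * s) * exp ((a + 2) * t) = exp ((a + 2) * (t - s)) := by
        rw [← exp_add]; ring_nf
      rw [mul_assoc, h3]
      have h4 : z 0 t = a ^ 2 * v 0 t - v 2 t := by rw [hz]; rfl
      linarith
    obtain ⟨d, hd, hdv⟩ := eventually_exp_le_of_forced (l := a) (m := a + 2) ha
      (by linarith) (mul_pos (by linarith) (exp_pos _)) (h.jet.mono (by norm_num)) g1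
    obtain ⟨s', hs'⟩ := Filter.eventually_atTop.1 hdv
    have hp : 0 < 1 + 6 / a := by positivity
    have hpc : a + 4 < (a + 2) * (1 + 6 / a) := by
      have : (a + 2) * (1 + 6 / a) = a + 8 + 12 / a := by field_simp; ring
      have : 0 < 12 / a := by positivity
      linarith
    obtain ⟨e, he, hew⟩ := eventually_exp_le_of_forced (l := a + 4) (s := s')
      (m := (a + 2) * (1 + 6 / a)) (d := κ * d ^ (1 + 6 / a)) (by linarith)
      hpc (by positivity) jw.neg (fun t ht => by
        have h1 := rpow_le_rpow (by positivity) (hs' t ht) hp.le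
        rw [mul_rpow hd.le (exp_pos _).le, ← exp_mul] at h1
        have h2 := mul_le_mul_of_nonneg_left h1 hκ.le
        have := hode t
        have h5 : (a + 2) * t * (1 + 6 / a) = (a + 2) * (1 + 6 / a) * t := by ring
        rw [h5] at h2
        linarith)
    obtain ⟨t, ht⟩ := hew.exists
    have := hw0 t
    have := mul_pos he (exp_pos ((a + 2) * (1 + 6 / a) * t))
    linarith
  by_contra! h0
  rcases le_total (helmholtz (a ^ 2) v 1 t) 0 with h1 | h1
  · exact key h t h0 h1
  · refine key h.reflect (-t) ?_ ?_ <;>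
    · rw [helmholtz_reflectJet]
      simpa [reflectJet] using by assumption

end IsPosSol

lemma le_exp_mul_of_abs_deriv_le {l : ℝ} {f : ℕ → ℝ → ℝ} (hf : IsJet 1 f)
    (h : ∀ t, |f 1 t| ≤ l * f 0 t) {s t : ℝ} (hst : s ≤ t) :
    f 0 t ≤ exp (l * (t - s)) * f 0 s ∧ f 0 s ≤ exp (l * (t - s)) * f 0 t := by
  constructor
  · have := le_of_hasDerivAt_nonneg (g := fun t => -(exp (-l * t) * f 0 t))
      (fun x => ((hasDerivAt_exp_mul (-l) x).mul (hf 0 (by norm_num) x)).neg) hst (by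
        intro x _
        have h1 := mul_nonneg (exp_pos (-l * x)).le (sub_nonneg.2 (abs_le.1 (h x)).2)
        simp only [zero_add]
        linarith)
    have h3 : exp (l * (t - s)) = exp (l * t) * exp (-l * s) := by
      rw [← exp_add]; ring_nf
    have h4 : exp (l * t) * exp (-l * t) = 1 := by
      rw [← exp_add]; ring_nf; exact exp_zero
    have h5 := mul_le_mul_of_nonneg_left this (exp_pos (l * t)).le
    calc f 0 t = exp (l * t) * exp (-l * t) * f 0 t := by rw [h4, one_mul]
      _ ≤ _ := by rw [h3]; linarith
  · have := le_of_hasDerivAt_nonneg (g := fun t => exp (l * t) * f 0 t)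
      (fun x => (hasDerivAt_exp_mul l x).mul (hf 0 (by norm_num) x)) hst (by
        intro x _
        have h1 := mul_nonneg (exp_pos (l * x)).le (neg_le_iff_add_nonneg.1 (abs_le.1 (h x)).1)
        simp only [zero_add]
        linarith)
    have h3 : exp (l * (t - s)) = exp (-l * s) * exp (l * t) := by
      rw [← exp_add]; ring_nf
    have h4 : exp (-l * s) * exp (l * s) = 1 := by
      rw [← exp_add]; ring_nf; exact exp_zero
    have h5 := mul_le_mul_of_nonneg_left this (exp_pos (-l * s)).le
    calc f 0 s = exp (-l * s) * exp (l * s) * f 0 s := by rw [h4, one_mul]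
      _ ≤ _ := by rw [h3]; linarith

/-- If `D² f = l² f - g` with `f` obeying Harnack bounds and `g` comparable to its values on unit
intervals, then `g` is controlled by `f`. -/
lemma forcing_le_const_mul {l E : ℝ} {f : ℕ → ℝ → ℝ} {g : ℝ → ℝ} (hl : 0 < l) (hE : 0 ≤ E)
    (hf : IsJet 2 f) (hg : ∀ t, g t = l ^ 2 * f 0 t - f 2 t)
    (h : ∀ t, |f 1 t| ≤ l * f 0 t)
    (hgE : ∀ t x, t ≤ x → x ≤ t + 1 → g t ≤ E * g x) (t : ℝ) :
    g t ≤ E * (l ^ 2 * exp l + l * exp l + l) * f 0 t := by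
  obtain ⟨x, hx, hx'⟩ := exists_hasDerivAt_eq_slope (f 1) (f 2) (show t < t + 1 by linarith)
    (hf.continuous (by norm_num)).continuousOn (fun x _ => hf 1 (by norm_num) x)
  have hf0 : ∀ s, 0 ≤ f 0 s := fun s =>
    nonneg_of_mul_nonneg_right ((abs_nonneg _).trans (h s)) hl
  have b : ∀ y, t ≤ y → y ≤ t + 1 → f 0 y ≤ exp l * f 0 t := by
    intro y hy hy'
    refine ((le_exp_mul_of_abs_deriv_le (hf.mono (by norm_num)) h hy).1).trans ?_
    refine mul_le_mul_of_nonneg_right (exp_le_exp.2 ?_) (hf0 t)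
    nlinarith
  have h1 := b x hx.1.le hx.2.le
  have h2 := b (t + 1) (by linarith) le_rfl
  have h3 := (abs_le.1 (h (t + 1))).1
  have h4 := (abs_le.1 (h t)).2
  have h5 := mul_le_mul_of_nonneg_left h1 (sq_nonneg l)
  have h6 := mul_le_mul_of_nonneg_left h2 hl.le
  have h7 : f 2 x = f 1 (t + 1) - f 1 t := by rw [hx']; simp
  have h8 : g x ≤ (l ^ 2 * exp l + l * exp l + l) * f 0 t := by
    rw [hg x, h7]; linarith
  calc g t ≤ E * g x := hgE t x hx.1.le hx.2.le
    _ ≤ E * ((l ^ 2 * exp l + l * exp l + l) * f 0 t) := mul_le_mul_of_nonneg_left h8 hE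
    _ = _ := by ring

namespace IsPosSol

variable {a κ : ℝ} {v : ℕ → ℝ → ℝ}

lemma abs_deriv_le (ha : 0 < a) (hκ : 0 < κ) (h : IsPosSol a κ v) (t : ℝ) :
    |v 1 t| ≤ a * v 0 t := by
  refine abs_deriv_le_of_nonneg ha (h.jet.mono (by norm_num)) (fun t => (h.pos t).le) ?_ t
  intro t
  have := h.helmholtz_nonneg ha hκ t
  simp only [helmholtz, zero_add] at this
  linarith

lemma abs_deriv_helmholtz_le (ha : 0 < a) (hκ : 0 < κ) (h : IsPosSol a κ v) (t : ℝ) :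
    |helmholtz (a ^ 2) v 1 t| ≤ (a + 2) * helmholtz (a ^ 2) v 0 t := by
  refine abs_deriv_le_of_nonneg (by linarith) ((h.jet.helmholtz _).mono (by norm_num))
    (h.helmholtz_nonneg ha hκ) ?_ t
  intro t
  have h1 := h.helmholtz_helmholtz_nonneg ha hκ t
  rw [helmholtz] at h1
  linarith

lemma abs_deriv_helmholtz_helmholtz_le (ha : 0 < a) (hκ : 0 < κ) (h : IsPosSol a κ v) (t : ℝ) :
    |helmholtz ((a + 2) ^ 2) (helmholtz (a ^ 2) v) 1 t|
      ≤ (a + 4) * helmholtz ((a + 2) ^ 2) (helmholtz (a ^ 2) v) 0 t := by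
  refine abs_deriv_le_of_nonneg (by linarith) ((h.jet.helmholtz (m := 4) _).helmholtz _)
    (h.helmholtz_helmholtz_nonneg ha hκ) ?_ t
  intro t
  have h1 := h.ode t
  have := mul_pos hκ (rpow_pos_of_pos (h.pos t) (1 + 6 / a))
  linarith

lemma exists_bound (ha : 0 < a) (hκ : 0 < κ) (h : IsPosSol a κ v) :
    ∃ M > 0, ∀ k < 6, ∀ t, |v k t| ≤ M := by
  have hv1 := h.abs_deriv_le ha hκ
  have hz1 := h.abs_deriv_helmholtz_le ha hκ
  have hw1 := h.abs_deriv_helmholtz_helmholtz_le ha hκ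
  have hz0 := h.helmholtz_nonneg ha hκ
  have hw0 := h.helmholtz_helmholtz_nonneg ha hκ
  have jz : IsJet 4 (helmholtz (a ^ 2) v) := h.jet.helmholtz _
  have jw : IsJet 2 (helmholtz ((a + 2) ^ 2) (helmholtz (a ^ 2) v)) := jz.helmholtz _
  obtain ⟨C₁, hC₁, hz⟩ : ∃ C > 0, ∀ t, helmholtz (a ^ 2) v 0 t ≤ C * v 0 t := by
    refine ⟨_, ?_, forcing_le_const_mul (E := exp (a + 2)) ha (exp_pos _).le
      (h.jet.mono (by norm_num)) (fun t => rfl) hv1 ?_⟩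
    · positivity
    · intro t x htx hx
      refine ((le_exp_mul_of_abs_deriv_le (jz.mono (by norm_num)) hz1 htx).2).trans ?_
      refine mul_le_mul_of_nonneg_right (exp_le_exp.2 ?_) (hz0 x)
      nlinarith
  obtain ⟨C₂, hC₂, hw⟩ : ∃ C > 0, ∀ t,
      helmholtz ((a + 2) ^ 2) (helmholtz (a ^ 2) v) 0 t ≤ C * helmholtz (a ^ 2) v 0 t := by
    refine ⟨_, ?_, forcing_le_const_mul (l := a + 2) (E := exp (a + 4)) (by linarith)
      (exp_pos _).le (jz.mono (by norm_num)) (fun t => rfl) hz1 ?_⟩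
    · positivity
    · intro t x htx hx
      refine ((le_exp_mul_of_abs_deriv_le (jw.mono (by norm_num)) hw1 htx).2).trans ?_
      refine mul_le_mul_of_nonneg_right (exp_le_exp.2 ?_) (hw0 x)
      nlinarith
  have hp : 0 < 1 + 6 / a := by positivity
  obtain ⟨C₃, hC₃, hv⟩ : ∃ C > 0, ∀ t, κ * v 0 t ^ (1 + 6 / a) ≤
      C * helmholtz ((a + 2) ^ 2) (helmholtz (a ^ 2) v) 0 t := by
    refine ⟨_, ?_, forcing_le_const_mul (l := a + 4) (E := exp a ^ (1 + 6 / a)) (by linarith)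
      (by positivity) jw (fun t => (h.ode t).symm) hw1 ?_⟩
    · positivity
    · intro t x htx hx
      have h1 : v 0 t ≤ exp a * v 0 x := by
        refine ((le_exp_mul_of_abs_deriv_le (h.jet.mono (by norm_num)) hv1 htx).2).trans ?_
        refine mul_le_mul_of_nonneg_right (exp_le_exp.2 ?_) (h.pos x).le
        nlinarith
      have h2 := rpow_le_rpow (h.pos t).le h1 hp.le
      rw [mul_rpow (exp_pos _).le (h.pos x).le] at h2
      calc κ * v 0 t ^ (1 + 6 / a)
          ≤ κ * (exp a ^ (1 + 6 / a) * v 0 x ^ (1 + 6 / a)) := mul_le_mul_of_nonneg_left h2 hκ.le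
        _ = _ := by ring
  obtain ⟨B, hB, hvB⟩ : ∃ B > 0, ∀ t, v 0 t ≤ B := by
    refine ⟨(C₃ * C₂ * C₁ / κ) ^ (6 / a)⁻¹, by positivity, fun t => ?_⟩
    have h0 := h.pos t
    have h1 : κ * v 0 t ^ (1 + 6 / a) ≤ C₃ * C₂ * C₁ * v 0 t := by
      have k1 := mul_le_mul_of_nonneg_left (hw t) hC₃.le
      have k2 := mul_le_mul_of_nonneg_left (hz t) (mul_pos hC₃ hC₂).le
      linarith [hv t]
    rw [rpow_add h0, rpow_one] at h1
    have h2 : v 0 t ^ (6 / a) ≤ C₃ * C₂ * C₁ / κ := by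
      rw [le_div_iff₀ hκ]
      refine le_of_mul_le_mul_right ?_ h0
      linarith
    have h3 := rpow_le_rpow (by positivity) h2 (inv_nonneg.2 (by positivity : 0 ≤ 6 / a))
    rwa [← rpow_mul h0.le, mul_inv_cancel₀ (by positivity), rpow_one] at h3
  have b0 : ∀ t, |v 0 t| ≤ B := fun t => by rw [abs_of_pos (h.pos t)]; exact hvB t
  have bz : ∀ t, |helmholtz (a ^ 2) v 0 t| ≤ C₁ * B := fun t => by
    rw [abs_of_nonneg (hz0 t)]
    exact (hz t).trans (mul_le_mul_of_nonneg_left (hvB t) hC₁.le)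
  have bw : ∀ t, |helmholtz ((a + 2) ^ 2) (helmholtz (a ^ 2) v) 0 t| ≤ C₂ * (C₁ * B) := fun t => by
    rw [abs_of_nonneg (hw0 t)]
    exact (hw t).trans (mul_le_mul_of_nonneg_left ((le_abs_self _).trans (bz t)) hC₂.le)
  have of_helmholtz : ∀ {c P Q : ℝ} {f : ℕ → ℝ → ℝ} {k : ℕ}, (∀ t, |f k t| ≤ P) →
      (∀ t, |helmholtz c f k t| ≤ Q) → ∀ t, |f (k + 2) t| ≤ |c| * P + Q := by
    intro c P Q f k hP hQ t
    have e : f (k + 2) t = c * f k t - helmholtz c f k t := by rw [helmholtz]; ring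
    rw [e]
    refine (abs_sub _ _).trans (add_le_add ?_ (hQ t))
    rw [abs_mul]
    exact mul_le_mul_of_nonneg_left (hP t) (abs_nonneg _)
  have b1 : ∀ t, |v 1 t| ≤ a * B := fun t =>
    (hv1 t).trans (mul_le_mul_of_nonneg_left (hvB t) ha.le)
  have bz1 : ∀ t, |helmholtz (a ^ 2) v 1 t| ≤ (a + 2) * (C₁ * B) := fun t =>
    (hz1 t).trans (mul_le_mul_of_nonneg_left ((le_abs_self _).trans (bz t)) (by linarith))
  have bw1 : ∀ t, |helmholtz ((a + 2) ^ 2) (helmholtz (a ^ 2) v) 1 t|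
      ≤ (a + 4) * (C₂ * (C₁ * B)) := fun t =>
    (hw1 t).trans (mul_le_mul_of_nonneg_left ((le_abs_self _).trans (bw t)) (by linarith))
  have b2 := of_helmholtz b0 bz
  have b3 := of_helmholtz b1 bz1
  have b4 := of_helmholtz b2 (of_helmholtz bz bw)
  have b5 := of_helmholtz b3 (of_helmholtz bz1 bw1)
  have : ∀ k < 6, ∃ M, ∀ t, |v k t| ≤ M := by
    intro k hk
    interval_cases k
    exacts [⟨_, b0⟩, ⟨_, b1⟩, ⟨_, b2⟩, ⟨_, b3⟩, ⟨_, b4⟩, ⟨_, b5⟩]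
  choose! M hM using this
  refine ⟨∑ k ∈ Finset.range 6, |M k| + 1, by positivity, fun k hk t => ?_⟩
  have := Finset.single_le_sum (f := fun k => |M k|) (fun i _ => abs_nonneg _)
    (Finset.mem_range.2 hk)
  have h2 := (hM k hk t).trans (le_abs_self _)
  linarith

end IsPosSol

/-- A cyclic chain `r ← p ← q ← -r`: each function solves `D² f = b² f + (forcing)` where the forcing
has the sign of the next function of the chain. The functions and their first derivatives are
`O(exp (ρ t))` for `t ≥ 0`, with rates below `b` that add up to zero. -/
structure CyclicSystem (b M ρp ρq ρr : ℝ) (p q r : ℕ → ℝ → ℝ) : Prop where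
  jet_p : IsJet 2 p
  jet_q : IsJet 2 q
  jet_r : IsJet 2 r
  sign_p : ∀ t, SignType.sign (p 2 t - b ^ 2 * p 0 t) = SignType.sign (q 0 t)
  sign_q : ∀ t, SignType.sign (q 2 t - b ^ 2 * q 0 t) = SignType.sign (-r 0 t)
  sign_r : ∀ t, SignType.sign (r 2 t - b ^ 2 * r 0 t) = SignType.sign (p 0 t)
  bound_p : ∀ k < 2, ∀ t, 0 ≤ t → |p k t| ≤ M * exp (ρp * t)
  bound_q : ∀ k < 2, ∀ t, 0 ≤ t → |q k t| ≤ M * exp (ρq * t)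
  bound_r : ∀ k < 2, ∀ t, 0 ≤ t → |r k t| ≤ M * exp (ρr * t)
  rate_p : ρp < b
  rate_q : ρq < b
  rate_r : ρr < b
  rate_sum : ρp + ρq + ρr = 0

lemma nonneg_of_sign_eq {x y : ℝ} (h : SignType.sign x = SignType.sign y) (hy : 0 ≤ y) :
    0 ≤ x := by
  rw [← sign_nonneg_iff, h, sign_nonneg_iff]; exact hy

lemma pos_of_sign_eq {x y : ℝ} (h : SignType.sign x = SignType.sign y) (hy : 0 < y) :
    0 < x := by
  rw [← sign_eq_one_iff, h, sign_eq_one_iff]; exact hy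

/-- The sign pattern of a solution which turns as slowly as possible around the origin. -/
structure SlowState (p q r : ℕ → ℝ → ℝ) (t : ℝ) : Prop where
  p0 : 0 ≤ p 0 t
  p1 : 0 < p 1 t
  q0 : 0 < q 0 t
  q1 : 0 < q 1 t
  r0 : r 0 t < 0

namespace CyclicSystem

variable {b M ρp ρq ρr : ℝ} {p q r : ℕ → ℝ → ℝ}

lemma rotate (h : CyclicSystem b M ρp ρq ρr p q r) :
    CyclicSystem b M ρr ρp ρq r p (fun k t => -q k t) where
  jet_p := h.jet_r
  jet_q := h.jet_p
  jet_r := h.jet_q.neg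
  sign_p := h.sign_r
  sign_q t := by simpa using h.sign_p t
  sign_r t := by
    have e : -q 2 t - b ^ 2 * -q 0 t = -(q 2 t - b ^ 2 * q 0 t) := by ring
    rw [e, Left.sign_neg, h.sign_q t, Left.sign_neg, neg_neg]
  bound_p := h.bound_r
  bound_q := h.bound_p
  bound_r k hk t ht := by simpa using h.bound_q k hk t ht
  rate_p := h.rate_r
  rate_q := h.rate_p
  rate_r := h.rate_q
  rate_sum := by linarith [h.rate_sum]

lemma neg (h : CyclicSystem b M ρp ρq ρr p q r) :
    CyclicSystem b M ρp ρq ρr (fun k t => -p k t) (fun k t => -q k t) (fun k t => -r k t) :=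
  h.rotate.rotate.rotate

/-- From a slow state, `r` vanishes later on, `p` and `q` growing in the meantime. -/
lemma exists_zero (hb : 0 < b) (h : CyclicSystem b M ρp ρq ρr p q r) {s : ℝ}
    (hs : SlowState p q r s) :
    ∃ t, s < t ∧ r 0 t = 0 ∧ ∀ x ∈ Set.Icc s t, r 0 x ≤ 0 := by
  have hcont : Continuous (r 0) := h.jet_r.continuous (by norm_num)
  by_cases hex : ∃ t, s ≤ t ∧ 0 ≤ r 0 t
  · obtain ⟨t, ht, hrt⟩ := hex
    have hclosed : IsClosed {x | s ≤ x ∧ 0 ≤ r 0 x} :=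
      (isClosed_le continuous_const continuous_id).inter (isClosed_le continuous_const hcont)
    have hbdd : BddBelow {x | s ≤ x ∧ 0 ≤ r 0 x} := ⟨s, fun x hx => hx.1⟩
    have hmem := hclosed.csInf_mem ⟨t, ht, hrt⟩ hbdd
    obtain ⟨u, hu⟩ : ∃ u, u = sInf {x | s ≤ x ∧ 0 ≤ r 0 x} := ⟨_, rfl⟩
    rw [← hu] at hmem
    have hlt : ∀ x, s ≤ x → x < u → r 0 x < 0 := by
      intro x hsx hxu
      by_contra! hx
      exact absurd (csInf_le hbdd ⟨hsx, hx⟩) (by rw [← hu]; exact not_le.2 hxu)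
    have hsu : s < u := hmem.1.lt_of_ne fun e => by
      have := hmem.2
      rw [← e] at this
      exact absurd hs.r0 (not_lt.2 this)
    have hle : ∀ x ∈ Set.Icc s u, r 0 x ≤ 0 := by
      intro x hx
      have hsub : Set.Icc s u ⊆ {x | r 0 x ≤ 0} := by
        rw [← closure_Ico hsu.ne]
        exact closure_minimal (fun y hy => (hlt y hy.1 hy.2).le)
          (isClosed_le hcont continuous_const)
      exact hsub hx
    exact ⟨u, hsu, le_antisymm (hle u ⟨hsu.le, le_rfl⟩) hmem.2, hle⟩
  · push Not at hex
    exfalso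
    have hq : ∀ t, s ≤ t → 0 ≤ q 0 t := by
      intro t ht
      have := half_mul_exp_le hb h.jet_q
        (fun x hx => sub_nonneg.1 (nonneg_of_sign_eq (h.sign_q x) (by linarith [hex x hx])))
        hs.q0.le hs.q1.le ht
      exact le_trans (by have := hs.q0; positivity) this
    have hp2 : ∀ x, s ≤ x → b ^ 2 * p 0 x ≤ p 2 x := fun x hx =>
      sub_nonneg.1 (nonneg_of_sign_eq (h.sign_p x) (hq x hx))
    have hp := fun t (ht : s ≤ t) => hyperbolicJet_le hb h.jet_p (s := s) (T := t)
      (fun x hx => hp2 x hx.1) t ⟨ht, le_rfl⟩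
    have hs1 : 0 < p 0 (s + 1) := by
      have h1 := (hp (s + 1) (by linarith)).1
      have h2 : 0 < sinh (b * (s + 1 - s)) := sinh_pos_iff.2 (by simpa using hb)
      have h3 := hs.p0
      have h4 := hs.p1
      have : 0 < p 0 s * cosh (b * (s + 1 - s)) + p 1 s * (sinh (b * (s + 1 - s)) / b) := by
        have := cosh_pos (b * (s + 1 - s))
        positivity
      linarith
    have hs1' : 0 ≤ p 1 (s + 1) := by
      have h1 := (hp (s + 1) (by linarith)).2
      have h2 : 0 < sinh (b * (s + 1 - s)) := sinh_pos_iff.2 (by simpa using hb)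
      have h3 := hs.p0
      have h4 := hs.p1
      have : 0 < p 0 s * (b * sinh (b * (s + 1 - s))) + p 1 s * cosh (b * (s + 1 - s)) := by
        have := cosh_pos (b * (s + 1 - s))
        positivity
      linarith
    obtain ⟨t, ht, hst, ht0⟩ := ((eventually_const_mul_exp_le h.rate_p
      (d := p 0 (s + 1) / 2 * exp (-b * (s + 1))) (by positivity) (M + 1)).and
      ((Filter.eventually_ge_atTop (s + 1)).and (Filter.eventually_ge_atTop 0))).exists
    have h1 := half_mul_exp_le hb h.jet_p (fun x hx => hp2 x (by linarith)) hs1.le hs1' hst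
    have h2 := (le_abs_self _).trans (h.bound_p 0 (by norm_num) t ht0)
    have h3 : exp (-b * (s + 1)) * exp (b * t) = exp (b * (t - (s + 1))) := by
      rw [← exp_add]; ring_nf
    rw [mul_assoc, h3] at ht
    linarith [exp_pos (ρp * t)]

lemma exists_next (hb : 0 < b) (h : CyclicSystem b M ρp ρq ρr p q r) {s : ℝ}
    (hs : SlowState p q r s) :
    ∃ t, s < t ∧ SlowState r p (fun k x => -q k x) t ∧
      4 * (p 1 s ^ 2 * r 0 s ^ 2 * (q 0 s * q 1 s))
        ≤ r 1 t ^ 2 * q 0 t ^ 2 * (p 0 t * p 1 t) := by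
  obtain ⟨t, hst, hrt, hr⟩ := h.exists_zero hb hs
  obtain ⟨A, hA⟩ : ∃ A, A = -r 0 s := ⟨_, rfl⟩
  obtain ⟨S, hS⟩ : ∃ S, S = sinh (b * (t - s)) / b := ⟨_, rfl⟩
  obtain ⟨C, hC⟩ : ∃ C, C = cosh (b * (t - s)) := ⟨_, rfl⟩
  have hS0 : 0 < S := hS ▸ div_pos (sinh_pos_iff.2 (mul_pos hb (sub_pos.2 hst))) hb
  have hbS : 0 < b * sinh (b * (t - s)) :=
    mul_pos hb (sinh_pos_iff.2 (mul_pos hb (sub_pos.2 hst)))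
  have hC1 : 1 ≤ C := hC ▸ one_le_cosh _
  have hA0 : 0 < A := by rw [hA]; linarith [hs.r0]
  have hp0 := hs.p0
  have hp1 := hs.p1
  have hq0 := hs.q0
  have hq1 := hs.q1
  have gq := fun x (hx : x ∈ Set.Icc s t) => hyperbolicJet_le hb h.jet_q (s := s) (T := t)
    (fun x hx => sub_nonneg.1 (nonneg_of_sign_eq (h.sign_q x) (by linarith [hr x hx]))) x hx
  have hq : ∀ x ∈ Set.Icc s t, 0 < q 0 x := by
    intro x hx
    refine lt_of_lt_of_le ?_ (gq x hx).1
    have h1 : 0 ≤ sinh (b * (x - s)) := sinh_nonneg_iff.2 (mul_nonneg hb.le (sub_nonneg.2 hx.1))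
    have h2 := cosh_pos (b * (x - s))
    positivity
  have gp := fun x (hx : x ∈ Set.Icc s t) => hyperbolicJet_le hb h.jet_p (s := s) (T := t)
    (fun x hx => sub_nonneg.1 (nonneg_of_sign_eq (h.sign_p x) (hq x hx).le)) x hx
  have hp : ∀ x ∈ Set.Icc s t, 0 ≤ p 0 x := by
    intro x hx
    refine le_trans ?_ (gp x hx).1
    have h1 : 0 ≤ sinh (b * (x - s)) := sinh_nonneg_iff.2 (mul_nonneg hb.le (sub_nonneg.2 hx.1))
    have h2 := cosh_pos (b * (x - s))
    positivity
  have gr := (hyperbolicJet_le hb h.jet_r.comp_neg (s := -t) (T := -s)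
    (fun x hx => by
      simpa using sub_nonneg.1 (nonneg_of_sign_eq (h.sign_r (-x))
        (hp (-x) ⟨by linarith [hx.2], by linarith [hx.1]⟩))) (-s) ⟨by linarith, le_rfl⟩).1
  have htt : t ∈ Set.Icc s t := ⟨hst.le, le_rfl⟩
  obtain ⟨gq0, -⟩ := gq t htt
  obtain ⟨gp0, gp1⟩ := gp t htt
  simp only [neg_neg, pow_zero, pow_one, one_mul, hrt, zero_mul, zero_add] at gr
  rw [show b * (-s - -t) = b * (t - s) by ring] at gr
  rw [← hS, ← hC] at gq0 gp0
  rw [← hC] at gp1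
  rw [← hS] at gr
  have e1 : A ≤ r 1 t * S := by rw [hA]; linarith
  have e2 : p 1 s * S ≤ p 0 t := by nlinarith
  have e3 : p 1 s * C ≤ p 1 t := by nlinarith
  have hr1 : 0 < r 1 t := pos_of_mul_pos_left (hA0.trans_le e1) hS0.le
  refine ⟨t, hst, ⟨hrt.ge, hr1, ?_, ?_, neg_neg_of_pos (hq t htt)⟩, ?_⟩
  · exact (mul_pos hp1 hS0).trans_le e2
  · exact (mul_pos hp1 (by linarith)).trans_le e3
  · have f1 : (p 1 s * S) * (p 1 s * C) ≤ p 0 t * p 1 t :=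
      mul_le_mul e2 e3 (by positivity) ((by positivity : 0 ≤ p 1 s * S).trans e2)
    have f2 : 4 * (q 0 s * q 1 s) * (C * S) ≤ q 0 t ^ 2 := by
      have : (q 0 s * C + q 1 s * S) ^ 2 ≤ q 0 t ^ 2 :=
        pow_le_pow_left₀ (by positivity) gq0 2
      nlinarith [sq_nonneg (q 0 s * C - q 1 s * S)]
    have f3 : r 0 s ^ 2 ≤ r 1 t ^ 2 * S ^ 2 := by
      have := pow_le_pow_left₀ hA0.le e1 2
      rw [hA] at this
      nlinarith
    calc 4 * (p 1 s ^ 2 * r 0 s ^ 2 * (q 0 s * q 1 s))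
        ≤ 4 * (p 1 s ^ 2 * (r 1 t ^ 2 * S ^ 2) * (q 0 s * q 1 s)) := by gcongr
      _ ≤ 4 * (p 1 s ^ 2 * (r 1 t ^ 2 * S ^ 2) * (q 0 s * q 1 s)) * C ^ 2 :=
          le_mul_of_one_le_right (by positivity) (one_le_pow₀ hC1)
      _ = r 1 t ^ 2 * (4 * (q 0 s * q 1 s) * (C * S)) * ((p 1 s * S) * (p 1 s * C)) := by ring
      _ ≤ r 1 t ^ 2 * q 0 t ^ 2 * (p 0 t * p 1 t) := by gcongr

lemma not_slowState (hb : 0 < b) (h : CyclicSystem b M ρp ρq ρr p q r) {s : ℝ} (hs0 : 0 ≤ s) :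
    ¬ SlowState p q r s := by
  intro hs
  obtain ⟨Φ, hΦ⟩ : ∃ Φ, Φ = p 1 s ^ 2 * r 0 s ^ 2 * (q 0 s * q 1 s) := ⟨_, rfl⟩
  have hΦ0 : 0 < Φ := by
    have h1 := hs.p1
    have h2 := sq_pos_of_neg hs.r0
    have h3 := hs.q0
    have h4 := hs.q1
    rw [hΦ]
    positivity
  have key : ∀ n : ℕ, ∃ (ρp ρq ρr : ℝ) (p q r : ℕ → ℝ → ℝ) (s : ℝ), 0 ≤ s ∧
      CyclicSystem b M ρp ρq ρr p q r ∧ SlowState p q r s ∧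
      4 ^ n * Φ ≤ p 1 s ^ 2 * r 0 s ^ 2 * (q 0 s * q 1 s) := by
    intro n
    induction n with
    | zero => exact ⟨_, _, _, p, q, r, s, hs0, h, hs, by rw [hΦ]; simp⟩
    | succ n ih =>
      obtain ⟨ρp, ρq, ρr, p, q, r, s, hs0, h, hs, hle⟩ := ih
      obtain ⟨t, hst, ht, hle'⟩ := h.exists_next hb hs
      refine ⟨_, _, _, _, _, _, t, hs0.trans hst.le, h.rotate, ht, ?_⟩
      rw [pow_succ, neg_sq]
      linarith
  obtain ⟨n, hn⟩ := pow_unbounded_of_one_lt (M ^ 6 / Φ) (by norm_num : (1 : ℝ) < 4)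
  obtain ⟨ρp, ρq, ρr, p, q, r, s, hs0, h, hs, hle⟩ := key n
  rw [div_lt_iff₀ hΦ0] at hn
  have k1 := pow_le_pow_left₀ (abs_nonneg _) (h.bound_p 1 (by norm_num) s hs0) 2
  have k2 := pow_le_pow_left₀ (abs_nonneg _) (h.bound_r 0 (by norm_num) s hs0) 2
  have k3 := (le_abs_self _).trans (h.bound_q 0 (by norm_num) s hs0)
  have k4 := (le_abs_self _).trans (h.bound_q 1 (by norm_num) s hs0)
  rw [sq_abs] at k1 k2
  have e : (exp (ρp * s) * exp (ρq * s) * exp (ρr * s)) = 1 := by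
    rw [← exp_add, ← exp_add, ← add_mul, ← add_mul, h.rate_sum, zero_mul, exp_zero]
  have q0 := hs.q0
  have q1 := hs.q1
  have : p 1 s ^ 2 * r 0 s ^ 2 * (q 0 s * q 1 s) ≤
      (M * exp (ρp * s)) ^ 2 * (M * exp (ρr * s)) ^ 2
        * ((M * exp (ρq * s)) * (M * exp (ρq * s))) := by
    gcongr
    exact q0.le.trans k3
  have e2 : (M * exp (ρp * s)) ^ 2 * (M * exp (ρr * s)) ^ 2
        * ((M * exp (ρq * s)) * (M * exp (ρq * s)))
      = M ^ 6 * (exp (ρp * s) * exp (ρq * s) * exp (ρr * s)) ^ 2 := by ring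
  rw [e2, e] at this
  linarith

end CyclicSystem

/-- The first three entries of the jet of `t ↦ exp (c * t) * f t`. -/
def twistJet (c : ℝ) (f : ℕ → ℝ → ℝ) : ℕ → ℝ → ℝ
  | 0, t => exp (c * t) * f 0 t
  | 1, t => exp (c * t) * (f 1 t + c * f 0 t)
  | _, t => exp (c * t) * (f 2 t + 2 * c * f 1 t + c ^ 2 * f 0 t)

lemma isJet_twistJet {c : ℝ} {f : ℕ → ℝ → ℝ} (hf : IsJet 2 f) : IsJet 2 (twistJet c f) := by
  intro k hk t
  have h0 := hf 0 (by norm_num) t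
  have h1 := hf 1 (by norm_num) t
  interval_cases k
  · refine ((hasDerivAt_exp_mul c t).mul h0).congr_deriv ?_
    simp only [twistJet, zero_add]
    ring
  · refine ((hasDerivAt_exp_mul c t).mul (h1.add (h0.const_mul c))).congr_deriv ?_
    simp only [twistJet, zero_add, Nat.reduceAdd, Pi.add_apply]
    ring

lemma abs_twistJet_le {c B M t : ℝ} {f : ℕ → ℝ → ℝ} {k : ℕ} (hc : |c| ≤ 2)
    (hf : ∀ k < 2, |f k t| ≤ B) (hM : 3 * B ≤ M) (hk : k < 2) :
    |twistJet c f k t| ≤ M * exp (c * t) := by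
  have b0 := hf 0 (by norm_num)
  have b1 := hf 1 (by norm_num)
  have hB := (abs_nonneg _).trans b0
  rw [mul_comm M]
  interval_cases k
  · simp only [twistJet]
    rw [abs_mul, abs_of_pos (exp_pos _)]
    exact mul_le_mul_of_nonneg_left (by linarith) (exp_pos _).le
  · simp only [twistJet]
    rw [abs_mul, abs_of_pos (exp_pos _)]
    refine mul_le_mul_of_nonneg_left ?_ (exp_pos _).le
    refine (abs_add_le _ _).trans ?_
    rw [abs_mul]
    have := mul_le_mul hc b0 (abs_nonneg _) (by norm_num)
    linarith

lemma exists_pos_of_deriv_pos {f : ℕ → ℝ → ℝ} (hf : IsJet 2 f) (h0 : f 0 0 = 0) (h1 : 0 < f 1 0) :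
    ∃ ε > 0, ∀ t ∈ Set.Ioc 0 ε, 0 < f 0 t ∧ 0 < f 1 t := by
  have hc : Continuous (f 1) := hf.continuous (by norm_num)
  obtain ⟨δ, hδ, hball⟩ := Metric.eventually_nhds_iff.1 (hc.continuousAt.eventually_const_lt h1)
  have key : ∀ x ∈ Set.Icc 0 (δ / 2), 0 < f 1 x := fun x hx => hball (by
    rw [dist_zero_right, norm_eq_abs, abs_of_nonneg hx.1]
    linarith [hx.2])
  refine ⟨δ / 2, by positivity, fun t ht => ⟨?_, key t ⟨ht.1.le, ht.2⟩⟩⟩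
  rw [← h0]
  exact lt_of_hasDerivAt_pos (hf 0 (by norm_num)) ht.1 fun x hx => key x ⟨hx.1.le, hx.2.trans ht.2⟩

namespace CyclicSystem

variable {b M ρp ρq ρr : ℝ} {p q r : ℕ → ℝ → ℝ}

lemma pos_r (hb : 0 < b) (h : CyclicSystem b M ρp ρq ρr p q r) {ε : ℝ} (hp0 : p 0 0 = 0)
    (hr0 : r 0 0 = 0) (hr1 : 0 ≤ r 1 0) (hp : ∀ t ∈ Set.Ioc 0 ε, 0 < p 0 t) :
    ∀ t ∈ Set.Ioc 0 ε, 0 < r 0 t ∧ 0 < r 1 t :=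
  pos_of_sq_mul_lt_deriv2 hb h.jet_r
    (fun t ht => sub_pos.1 (pos_of_sign_eq (h.sign_r t) (hp t ht))) hr0 hr1
    (sub_nonneg.1 (nonneg_of_sign_eq (h.sign_r 0) hp0.ge))

lemma deriv_nonpos (hb : 0 < b) (h : CyclicSystem b M ρp ρq ρr p q r) (hp0 : p 0 0 = 0)
    (hq0 : q 0 0 = 0) (hr0 : r 0 0 = 0) (hr1 : r 1 0 = 0) :
    p 1 0 ≤ 0 ∧ (p 1 0 = 0 → q 1 0 ≤ 0) := by
  constructor
  · by_contra! hp1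
    obtain ⟨ε, hε, hp⟩ := exists_pos_of_deriv_pos h.jet_p hp0 hp1
    have hr := h.pos_r hb hp0 hr0 hr1.ge fun t ht => (hp t ht).1
    rcases lt_or_ge 0 (q 1 0) with hq1 | hq1
    · obtain ⟨δ, hδ, hq⟩ := exists_pos_of_deriv_pos h.jet_q hq0 hq1
      have hm : 0 < min ε δ := lt_min hε hδ
      have hp := hp _ ⟨hm, min_le_left _ _⟩
      have hr := hr _ ⟨hm, min_le_left _ _⟩
      have hq := hq _ ⟨hm, min_le_right _ _⟩
      exact h.rotate.not_slowState hb hm.le ⟨hr.1.le, hr.2, hp.1, hp.2, neg_neg_of_pos hq.1⟩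
    · have hq := h.rotate.pos_r hb hr0 (by simp [hq0]) (by simpa using hq1)
        fun t ht => (hr t ht).1
      have hm : ε ∈ Set.Ioc 0 ε := ⟨hε, le_rfl⟩
      exact h.rotate.rotate.not_slowState hb hε.le
        ⟨(hq ε hm).1.le, (hq ε hm).2, (hr ε hm).1, (hr ε hm).2, neg_neg_of_pos (hp ε hm).1⟩
  · intro hp1
    by_contra! hq1
    obtain ⟨ε, hε, hq⟩ := exists_pos_of_deriv_pos h.jet_q hq0 hq1
    have hp := pos_of_sq_mul_lt_deriv2 hb h.jet_p
      (fun t ht => sub_pos.1 (pos_of_sign_eq (h.sign_p t) (hq t ht).1)) hp0 hp1.ge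
      (sub_nonneg.1 (nonneg_of_sign_eq (h.sign_p 0) hq0.ge))
    have hr := h.pos_r hb hp0 hr0 hr1.ge fun t ht => (hp t ht).1
    have hm : ε ∈ Set.Ioc 0 ε := ⟨hε, le_rfl⟩
    exact h.rotate.not_slowState hb hε.le
      ⟨(hr ε hm).1.le, (hr ε hm).2, (hp ε hm).1, (hp ε hm).2, neg_neg_of_pos (hq ε hm).1⟩

lemma deriv_eq_zero (hb : 0 < b) (h : CyclicSystem b M ρp ρq ρr p q r) (hp0 : p 0 0 = 0)
    (hq0 : q 0 0 = 0) (hr0 : r 0 0 = 0) (hr1 : r 1 0 = 0) : p 1 0 = 0 ∧ q 1 0 = 0 := by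
  have h1 := h.deriv_nonpos hb hp0 hq0 hr0 hr1
  have h2 := h.neg.deriv_nonpos hb (by simp [hp0]) (by simp [hq0]) (by simp [hr0]) (by simp [hr1])
  have hp : p 1 0 = 0 := by linarith [h1.1, h2.1]
  have k1 := h1.2 hp
  have k2 := h2.2 (by simp [hp])
  exact ⟨hp, by linarith⟩

end CyclicSystem

namespace IsPosSol

variable {a κ : ℝ} {v : ℕ → ℝ → ℝ}

lemma ode_expand (h : IsPosSol a κ v) (t : ℝ) :
    v 6 t - (a ^ 2 + (a + 2) ^ 2 + (a + 4) ^ 2) * v 4 t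
      + (a ^ 2 * (a + 2) ^ 2 + a ^ 2 * (a + 4) ^ 2 + (a + 2) ^ 2 * (a + 4) ^ 2) * v 2 t
      - a ^ 2 * (a + 2) ^ 2 * (a + 4) ^ 2 * v 0 t = -(κ * v 0 t ^ (1 + 6 / a)) := by
  rw [← h.ode t]
  simp only [helmholtz, Nat.reduceAdd]
  ring

/-- Two solutions `v`, `w` whose even derivatives and first derivatives agree at the origin
have the same third and fifth derivatives there. -/
lemma sub_deriv_eq_zero {w : ℕ → ℝ → ℝ} (ha : 0 < a) (hκ : 0 < κ) (hv : IsPosSol a κ v)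
    (hw : IsPosSol a κ w) (h0 : v 0 0 - w 0 0 = 0) (h1 : v 1 0 - w 1 0 = 0)
    (h2 : v 2 0 - w 2 0 = 0) (h4 : v 4 0 - w 4 0 = 0) :
    v 3 0 - w 3 0 = 0 ∧ v 5 0 - w 5 0 = 0 := by
  obtain ⟨D, hD⟩ : ∃ D : ℕ → ℝ → ℝ, D = fun k t => v k t - w k t := ⟨_, rfl⟩
  have jD : IsJet 6 D := hD ▸ hv.jet.sub hw.jet
  have e : ∀ k t, v k t - w k t = D k t := fun k t => by rw [hD]
  rw [e] at h0 h1 h2 h4 ⊢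
  rw [e]
  obtain ⟨B, hB, hbd⟩ : ∃ B > 0, ∀ k < 6, ∀ t, |D k t| ≤ B := by
    obtain ⟨B₁, hB₁, hb₁⟩ := hv.exists_bound ha hκ
    obtain ⟨B₂, hB₂, hb₂⟩ := hw.exists_bound ha hκ
    refine ⟨B₁ + B₂, by positivity, fun k hk t => ?_⟩
    rw [← e]
    exact (abs_sub _ _).trans (add_le_add (hb₁ k hk t) (hb₂ k hk t))
  have hode : ∀ t, SignType.sign (D 6 t - (a ^ 2 + (a + 2) ^ 2 + (a + 4) ^ 2) * D 4 t
      + (a ^ 2 * (a + 2) ^ 2 + a ^ 2 * (a + 4) ^ 2 + (a + 2) ^ 2 * (a + 4) ^ 2) * D 2 t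
      - a ^ 2 * (a + 2) ^ 2 * (a + 4) ^ 2 * D 0 t) = SignType.sign (-D 0 t) := by
    intro t
    have k1 := hv.ode_expand t
    have k2 := hw.ode_expand t
    have hp : 0 < 1 + 6 / a := by positivity
    have k3 : D 6 t - (a ^ 2 + (a + 2) ^ 2 + (a + 4) ^ 2) * D 4 t
      + (a ^ 2 * (a + 2) ^ 2 + a ^ 2 * (a + 4) ^ 2 + (a + 2) ^ 2 * (a + 4) ^ 2) * D 2 t
      - a ^ 2 * (a + 2) ^ 2 * (a + 4) ^ 2 * D 0 t
      = κ * (w 0 t ^ (1 + 6 / a) - v 0 t ^ (1 + 6 / a)) := by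
      simp only [← e]
      linarith
    rw [k3, sign_mul, sign_pos hκ, one_mul, ← e, neg_sub]
    rcases lt_trichotomy (v 0 t) (w 0 t) with hlt | heq | hgt
    · rw [sign_pos (sub_pos.2 hlt), sign_pos (sub_pos.2 (rpow_lt_rpow (hv.pos t).le hlt hp))]
    · rw [heq, sub_self, sub_self]
    · rw [sign_neg (sub_neg.2 hgt), sign_neg (sub_neg.2 (rpow_lt_rpow (hw.pos t).le hgt hp))]
  obtain ⟨y, hy⟩ : ∃ y : ℕ → ℝ → ℝ,
      y = fun k t => D (k + 2) t - 4 * D (k + 1) t - a * (a + 4) * D k t := ⟨_, rfl⟩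
  have jy : IsJet 4 y := by
    rw [hy]
    exact fun k hk t => ((jD (k + 2) (by omega) t).sub ((jD (k + 1) (by omega) t).const_mul 4)).sub
      ((jD k (by omega) t).const_mul _)
  obtain ⟨z, hz⟩ : ∃ z : ℕ → ℝ → ℝ, z = fun k t => D (k + 4) t
      - (2 * (a * (a + 4)) + 16) * D (k + 2) t + (a * (a + 4)) ^ 2 * D k t := ⟨_, rfl⟩
  have jz : IsJet 2 z := by
    rw [hz]
    exact fun k hk t => ((jD (k + 4) (by omega) t).sub
      ((jD (k + 2) (by omega) t).const_mul _)).add ((jD k (by omega) t).const_mul _)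
  obtain ⟨P, hP, hby⟩ : ∃ P > 0, ∀ k < 2, ∀ t, |y k t| ≤ P := by
    refine ⟨B + 4 * B + a * (a + 4) * B, by positivity, fun k hk t => ?_⟩
    have b0 := abs_le.1 (hbd k (by omega) t)
    have b1 := abs_le.1 (hbd (k + 1) (by omega) t)
    have b2 := abs_le.1 (hbd (k + 2) (by omega) t)
    have ac : 0 < a * (a + 4) := by positivity
    rw [hy, abs_le]
    constructor <;> nlinarith
  obtain ⟨Q, hQ, hbz⟩ : ∃ Q > 0, ∀ k < 2, ∀ t, |z k t| ≤ Q := by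
    refine ⟨B + (2 * (a * (a + 4)) + 16) * B + (a * (a + 4)) ^ 2 * B, by positivity,
      fun k hk t => ?_⟩
    have b0 := abs_le.1 (hbd k (by omega) t)
    have b2 := abs_le.1 (hbd (k + 2) (by omega) t)
    have b4 := abs_le.1 (hbd (k + 4) (by omega) t)
    have ac : 0 < 2 * (a * (a + 4)) + 16 := by positivity
    have ac2 : 0 < (a * (a + 4)) ^ 2 := by positivity
    rw [hz, abs_le]
    constructor <;> nlinarith
  have hsys : CyclicSystem (a + 2) (3 * B + 3 * P + Q) 2 0 (-2) (twistJet 2 y) z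
      (twistJet (-2) D) := by
    refine ⟨isJet_twistJet (jy.mono (by norm_num)), jz, isJet_twistJet (jD.mono (by norm_num)),
      fun t => ?_, fun t => ?_, fun t => ?_, fun k hk t _ => ?_, fun k hk t _ => ?_,
      fun k hk t _ => ?_, by linarith, by linarith, by linarith, by norm_num⟩
    · have : twistJet 2 y 2 t - (a + 2) ^ 2 * twistJet 2 y 0 t = exp (2 * t) * z 0 t := by
        simp only [twistJet, hy, hz, Nat.reduceAdd]
        ring
      rw [this, sign_mul, sign_pos (exp_pos _), one_mul]
    · have : SignType.sign (-twistJet (-2) D 0 t) = SignType.sign (-D 0 t) := by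
        simp only [twistJet]
        rw [← mul_neg, sign_mul, sign_pos (exp_pos _), one_mul]
      rw [this, ← hode t]
      congr 1
      simp only [hz, Nat.reduceAdd]
      ring
    · have : twistJet (-2) D 2 t - (a + 2) ^ 2 * twistJet (-2) D 0 t = exp (-2 * t) * y 0 t := by
        simp only [twistJet, hy, Nat.reduceAdd]
        ring
      rw [this, sign_mul, sign_pos (exp_pos _), one_mul]
      simp only [twistJet]
      rw [sign_mul, sign_pos (exp_pos _), one_mul]
    · exact abs_twistJet_le (by norm_num) (fun k hk => hby k hk t) (by linarith) hk
    · rw [zero_mul, exp_zero, mul_one]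
      exact (hbz k hk t).trans (by linarith)
    · exact abs_twistJet_le (by norm_num) (fun k hk => hbd k (by omega) t) (by linarith) hk
  have := hsys.deriv_eq_zero (by linarith) (by simp [twistJet, hy, h0, h1, h2])
    (by simp [hz, h0, h2, h4]) (by simp [twistJet, h0]) (by simp [twistJet, h0, h1])
  obtain ⟨k1, k2⟩ := this
  simp only [twistJet, hy, zero_add, Nat.reduceAdd, h0, h1, h2, mul_zero, exp_zero] at k1
  simp only [hz, Nat.reduceAdd, h1] at k2
  have h3 : D 3 0 = 0 := by linarith
  rw [h3] at k2
  exact ⟨h3, by linarith⟩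

end IsPosSol

lemma eq_zero_of_abs_deriv_le {C : ℝ} {f : ℕ → ℝ → ℝ} (hf : IsJet 6 f)
    (h6 : ∀ t, |f 6 t| ≤ C * |f 0 t|
      + C * |f 2 t| + C * |f 4 t|) (hC : 0 ≤ C) (h0 : ∀ k < 6, f k 0 = 0) {t : ℝ} (ht : 0 ≤ t) :
    f 0 t = 0 := by
  obtain ⟨L, hL⟩ : ∃ L, L = 10 + 10 * C := ⟨_, rfl⟩
  have hd : ∀ x, HasDerivAt (fun x => -(exp (-L * x) * ∑ k ∈ Finset.range 6, f k x ^ 2))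
      (exp (-L * x) * (L * ∑ k ∈ Finset.range 6, f k x ^ 2
        - ∑ k ∈ Finset.range 6, 2 * f k x * f (k + 1) x)) x := by
    intro x
    have h1 : HasDerivAt (fun x => ∑ k ∈ Finset.range 6, f k x ^ 2)
        (∑ k ∈ Finset.range 6, 2 * f k x * f (k + 1) x) x :=
      HasDerivAt.fun_sum fun k hk => by
        simpa using (hf k (Finset.mem_range.1 hk) x).fun_pow 2
    refine ((hasDerivAt_exp_mul (-L) x).mul h1).neg.congr_deriv ?_
    ring
  have hle := le_of_hasDerivAt_nonneg hd ht fun x _ => by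
    refine mul_nonneg (exp_pos _).le (sub_nonneg.2 ?_)
    simp only [Finset.sum_range_succ, Finset.sum_range_zero, zero_add, Nat.reduceAdd]
    have am : ∀ y z : ℝ, 2 * y * z ≤ y ^ 2 + z ^ 2 := fun y z => by nlinarith [sq_nonneg (y - z)]
    have cm : ∀ y z : ℝ, 2 * |y| * (C * |z|) ≤ C * (y ^ 2 + z ^ 2) := fun y z => by
      have := am |y| |z|
      rw [sq_abs, sq_abs] at this
      nlinarith
    have h5 : 2 * f 5 x * f 6 x ≤ 2 * |f 5 x| * |f 6 x| := by
      have := le_abs_self (f 5 x * f 6 x)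
      rw [abs_mul] at this
      linarith
    have h5' := mul_le_mul_of_nonneg_left (h6 x) (abs_nonneg (f 5 x))
    have q0 := mul_nonneg hC (sq_nonneg (f 0 x))
    have q1 := mul_nonneg hC (sq_nonneg (f 1 x))
    have q2 := mul_nonneg hC (sq_nonneg (f 2 x))
    have q3 := mul_nonneg hC (sq_nonneg (f 3 x))
    have q4 := mul_nonneg hC (sq_nonneg (f 4 x))
    have q5 := mul_nonneg hC (sq_nonneg (f 5 x))
    rw [hL]
    linarith [am (f 0 x) (f 1 x), am (f 1 x) (f 2 x), am (f 2 x) (f 3 x), am (f 3 x) (f 4 x),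
      am (f 4 x) (f 5 x), cm (f 5 x) (f 0 x), cm (f 5 x) (f 2 x), cm (f 5 x) (f 4 x),
      sq_nonneg (f 0 x), sq_nonneg (f 1 x), sq_nonneg (f 2 x), sq_nonneg (f 3 x),
      sq_nonneg (f 4 x), sq_nonneg (f 5 x)]
  have hz : ∑ k ∈ Finset.range 6, f k 0 ^ 2 = 0 :=
    Finset.sum_eq_zero fun k hk => by rw [h0 k (Finset.mem_range.1 hk), zero_pow two_ne_zero]
  simp only [hz, mul_zero, neg_zero] at hle
  have hs : ∑ k ∈ Finset.range 6, f k t ^ 2 ≤ 0 :=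
    nonpos_of_mul_nonpos_right (by linarith) (exp_pos (-L * t))
  have := Finset.single_le_sum (f := fun k => f k t ^ 2) (fun k _ => sq_nonneg (f k t))
    (Finset.mem_range.2 (show 0 < 6 by norm_num))
  exact pow_eq_zero_iff two_ne_zero |>.1 (le_antisymm (this.trans hs) (sq_nonneg _))

lemma abs_rpow_sub_rpow_le {p B x y : ℝ} (hp : 1 ≤ p) (hx : 0 < x) (hy : 0 < y) (hxB : x ≤ B)
    (hyB : y ≤ B) : |x ^ p - y ^ p| ≤ p * B ^ (p - 1) * |x - y| := by
  have := Convex.norm_image_sub_le_of_norm_hasDerivWithin_le (f := fun x : ℝ => x ^ p)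
    (f' := fun x => p * x ^ (p - 1)) (C := p * B ^ (p - 1)) (s := Set.Ioc 0 B) (x := y) (y := x)
    (fun z hz => (hasDerivAt_rpow_const (Or.inl hz.1.ne')).hasDerivWithinAt)
    (fun z hz => by
      have h0 : 0 ≤ p := by linarith
      rw [norm_eq_abs, abs_of_nonneg (mul_nonneg h0 (rpow_nonneg hz.1.le _))]
      exact mul_le_mul_of_nonneg_left (rpow_le_rpow hz.1.le hz.2 (by linarith)) h0)
    (convex_Ioc 0 B) ⟨hy, hyB⟩ ⟨hx, hxB⟩
  simpa using this

namespace IsPosSol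

variable {a κ : ℝ} {v : ℕ → ℝ → ℝ}

lemma eq_of_initial_eq {w : ℕ → ℝ → ℝ} (ha : 0 < a) (hκ : 0 < κ) (hv : IsPosSol a κ v)
    (hw : IsPosSol a κ w) (h : ∀ k < 6, v k 0 = w k 0) {t : ℝ} (ht : 0 ≤ t) : v 0 t = w 0 t := by
  obtain ⟨B₁, hB₁, hb₁⟩ := hv.exists_bound ha hκ
  obtain ⟨B₂, hB₂, hb₂⟩ := hw.exists_bound ha hκ
  have hp : 1 ≤ 1 + 6 / a := by
    have : 0 < 6 / a := by positivity
    linarith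
  obtain ⟨L, hL⟩ : ∃ L, L = (1 + 6 / a) * (B₁ + B₂) ^ (1 + 6 / a - 1) := ⟨_, rfl⟩
  have hL0 : 0 ≤ L := by rw [hL]; positivity
  have hlip : ∀ t, |κ * v 0 t ^ (1 + 6 / a) - κ * w 0 t ^ (1 + 6 / a)|
      ≤ κ * L * |v 0 t - w 0 t| := by
    intro t
    have k1 := (le_abs_self _).trans (hb₁ 0 (by norm_num) t)
    have k2 := (le_abs_self _).trans (hb₂ 0 (by norm_num) t)
    rw [← mul_sub, abs_mul, abs_of_pos hκ, mul_assoc, hL]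
    exact mul_le_mul_of_nonneg_left
      (abs_rpow_sub_rpow_le hp (hv.pos t) (hw.pos t) (by linarith) (by linarith)) hκ.le
  obtain ⟨α, hα⟩ : ∃ α, α = a ^ 2 + (a + 2) ^ 2 + (a + 4) ^ 2 := ⟨_, rfl⟩
  obtain ⟨β, hβ⟩ : ∃ β, β = a ^ 2 * (a + 2) ^ 2 + a ^ 2 * (a + 4) ^ 2
    + (a + 2) ^ 2 * (a + 4) ^ 2 := ⟨_, rfl⟩
  obtain ⟨γ, hγ⟩ : ∃ γ, γ = a ^ 2 * (a + 2) ^ 2 * (a + 4) ^ 2 := ⟨_, rfl⟩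
  have hα0 : 0 ≤ α := by rw [hα]; positivity
  have hβ0 : 0 ≤ β := by rw [hβ]; positivity
  have hγ0 : 0 ≤ γ := by rw [hγ]; positivity
  refine sub_eq_zero.1 (eq_zero_of_abs_deriv_le (C := α + β + γ + κ * L) (hv.jet.sub hw.jet)
    (fun t => ?_) (by positivity) (fun k hk => sub_eq_zero.2 (h k hk)) ht)
  have k1 := hv.ode_expand t
  have k2 := hw.ode_expand t
  rw [← hα, ← hβ, ← hγ] at k1 k2
  have e : v 6 t - w 6 t = α * (v 4 t - w 4 t) - β * (v 2 t - w 2 t) + γ * (v 0 t - w 0 t)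
      - (κ * v 0 t ^ (1 + 6 / a) - κ * w 0 t ^ (1 + 6 / a)) := by linarith
  have s0 := abs_nonneg (v 0 t - w 0 t)
  have s2 := abs_nonneg (v 2 t - w 2 t)
  have s4 := abs_nonneg (v 4 t - w 4 t)
  have hκL : 0 ≤ κ * L := by positivity
  calc |v 6 t - w 6 t|
      ≤ α * |v 4 t - w 4 t| + β * |v 2 t - w 2 t| + γ * |v 0 t - w 0 t|
        + κ * L * |v 0 t - w 0 t| := by
        rw [e]
        refine (abs_sub _ _).trans (add_le_add ((abs_add_le _ _).trans (add_le_add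
          ((abs_sub _ _).trans (add_le_add ?_ ?_)) ?_)) (hlip t))
        · rw [abs_mul, abs_of_nonneg hα0]
        · rw [abs_mul, abs_of_nonneg hβ0]
        · rw [abs_mul, abs_of_nonneg hγ0]
    _ ≤ _ := by
        have := mul_nonneg (add_nonneg hα0 hβ0) s0
        have := mul_nonneg (add_nonneg (add_nonneg hα0 hγ0) hκL) s2
        have := mul_nonneg (add_nonneg (add_nonneg hβ0 hγ0) hκL) s4
        linarith

/-- A positive solution is symmetric about each of its critical points. -/
lemma symmetric (ha : 0 < a) (hκ : 0 < κ) (h : IsPosSol a κ v) {s : ℝ} (hs : v 1 s = 0) (t : ℝ) :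
    v 0 (s + t) = v 0 (s - t) := by
  have hv := h.shift s
  have hw := hv.reflect
  obtain ⟨h3, h5⟩ := hv.sub_deriv_eq_zero ha hκ hw (by simp [reflectJet])
    (by simp [reflectJet, hs]) (by simp [reflectJet]) (by norm_num [reflectJet])
  have key : ∀ {t : ℝ}, 0 ≤ t → v 0 (s + t) = v 0 (s - t) := by
    intro t ht
    have := hv.eq_of_initial_eq ha hκ hw (fun k hk => ?_) ht
    · simpa [reflectJet, sub_eq_add_neg] using this
    · interval_cases k
      · simp [reflectJet]
      · simp [reflectJet, hs]
      · simp [reflectJet]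
      · linarith
      · norm_num [reflectJet]
      · linarith
  rcases le_total 0 t with ht | ht
  · exact key ht
  · simpa [sub_eq_add_neg] using (key (neg_nonneg.2 ht)).symm

end IsPosSol

lemma le_of_isLocalMax_of_symmetric {f f' : ℝ → ℝ} (hf : ∀ t, HasDerivAt f (f' t) t)
    (hsymm : ∀ s, f' s = 0 → ∀ t, f (s + t) = f (s - t)) {t₀ : ℝ} (hmax : IsLocalMax f t₀)
    (t : ℝ) : f t ≤ f t₀ := by
  have hcont : Continuous f := continuous_iff_continuousAt.2 fun t => (hf t).continuousAt
  have h0 := hsymm t₀ (hmax.hasDerivAt_eq_zero (hf t₀))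
  have key : ∀ t, t₀ ≤ t → f t ≤ f t₀ := by
    by_contra! hex
    obtain ⟨u, hu, hfu⟩ := hex
    obtain ⟨T, hT⟩ : ∃ T, T = sInf {x | t₀ ≤ x ∧ f t₀ < f x} := ⟨_, rfl⟩
    have hbdd : BddBelow {x | t₀ ≤ x ∧ f t₀ < f x} := ⟨t₀, fun x hx => hx.1⟩
    have hne : {x | t₀ ≤ x ∧ f t₀ < f x}.Nonempty := ⟨u, hu, hfu⟩
    have hbelow : ∀ x, t₀ ≤ x → x < T → f x ≤ f t₀ := by
      intro x hx hxT
      by_contra! hlt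
      rw [hT] at hxT
      exact absurd (csInf_le hbdd ⟨hx, hlt⟩) (not_le.2 hxT)
    obtain ⟨δ, hδ, hball⟩ := Metric.eventually_nhds_iff.1 hmax
    have hT0 : t₀ < T := by
      have : t₀ + δ ≤ T := by
        rw [hT]
        refine le_csInf hne fun x hx => ?_
        by_contra! hlt
        have h1 := hball (y := x) (by
          rw [dist_eq, abs_of_nonneg (sub_nonneg.2 hx.1)]
          linarith)
        exact absurd hx.2 (not_lt.2 h1)
      linarith
    have hleT : f T ≤ f t₀ := by
      have hsub : Set.Icc t₀ T ⊆ {x | f x ≤ f t₀} := by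
        rw [← closure_Ico hT0.ne]
        exact closure_minimal (fun y hy => hbelow y hy.1 hy.2)
          (isClosed_le hcont continuous_const)
      exact hsub ⟨hT0.le, le_rfl⟩
    have hgeT : f t₀ ≤ f T := by
      have hmem : T ∈ closure {x | t₀ ≤ x ∧ f t₀ < f x} := hT ▸ csInf_mem_closure hne hbdd
      exact closure_minimal (fun y hy => hy.2.le) (isClosed_le continuous_const hcont) hmem
    obtain ⟨s, hs, hs0⟩ := exists_hasDerivAt_eq_zero hT0 hcont.continuousOn
      (le_antisymm hgeT hleT) fun x _ => hf x
    have hle : ∀ x ∈ Set.Icc (2 * t₀ - T) T, f x ≤ f t₀ := by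
      have hr : ∀ x ∈ Set.Icc t₀ T, f x ≤ f t₀ := by
        intro x hx
        rcases hx.2.lt_or_eq with hlt | rfl
        · exact hbelow x hx.1 hlt
        · exact hleT
      intro x hx
      rcases le_total t₀ x with h1 | h1
      · exact hr x ⟨h1, hx.2⟩
      · have h2 := h0 (x - t₀)
        rw [add_sub_cancel] at h2
        rw [h2]
        exact hr _ ⟨by linarith, by linarith [hx.1]⟩
    obtain ⟨x, hx, hxT⟩ := (csInf_lt_iff hbdd hne).1
      (show sInf {x | t₀ ≤ x ∧ f t₀ < f x} < T + 2 * (s - t₀) by linarith [hs.1])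
    have hTx : T ≤ x := hT ▸ csInf_le hbdd hx
    have h3 := hsymm s hs0 (x - s)
    rw [add_sub_cancel] at h3
    refine absurd hx.2 (not_lt.2 (h3 ▸ hle _ ⟨?_, ?_⟩)) <;> linarith [hs.1, hs.2]
  rcases le_total t₀ t with ht | ht
  · exact key t ht
  · have h2 := h0 (t - t₀)
    rw [add_sub_cancel] at h2
    rw [h2]
    exact key _ (by linarith)

lemma le_of_helmholtz_le {l A B : ℝ} {f : ℕ → ℝ → ℝ} (hl : 0 < l) (hf : IsJet 2 f)
    (hB : ∀ t, f 0 t ≤ B) (h : ∀ t, helmholtz (l ^ 2) f 0 t ≤ l ^ 2 * A) (t : ℝ) : f 0 t ≤ A := by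
  have := nonpos_of_bounded_of_sq_mul_le_deriv2 (M := B - A) hl (hf.sub (isJet_const 2 A))
    (fun t => by simpa using hB t) (fun t => by
      have := h t
      simp only [helmholtz, zero_add] at this
      simp only [if_true, OfNat.ofNat_ne_zero, if_false]
      linarith) t
  simpa using this

lemma eq_zero_of_nonneg_of_eq_zero {l t₀ : ℝ} {f : ℕ → ℝ → ℝ} (hl : 0 < l) (hf : IsJet 2 f)
    (h0 : ∀ t, 0 ≤ f 0 t) (h : ∀ t, 0 ≤ helmholtz (l ^ 2) f 0 t) (ht₀ : f 0 t₀ = 0) (t : ℝ) :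
    f 0 t = 0 := by
  have h1 := abs_deriv_le_of_nonneg hl hf h0 fun t => by
    have := h t
    simp only [helmholtz, zero_add] at this
    linarith
  refine le_antisymm ?_ (h0 t)
  rcases le_total t t₀ with ht | ht
  · simpa [ht₀] using (le_exp_mul_of_abs_deriv_le (hf.mono (by norm_num)) h1 ht).2
  · simpa [ht₀] using (le_exp_mul_of_abs_deriv_le (hf.mono (by norm_num)) h1 ht).1

namespace IsPosSol

variable {a κ : ℝ} {v : ℕ → ℝ → ℝ}

/-- The comparison argument behind both bounds, `σ = 1` for maxima and `σ = -1` for minima. -/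
lemma eq_of_extremum {σ t₀ : ℝ} (ha : 0 < a) (hκ : 0 < κ) (h : IsPosSol a κ v)
    (hext : ∀ t, σ * v 0 t ≤ σ * v 0 t₀)
    (hode : ∀ t, σ * (κ * v 0 t ^ (1 + 6 / a))
      ≤ (a + 4) ^ 2 * ((a + 2) ^ 2 * (a ^ 2 * (σ * v 0 t₀)))) (t : ℝ) :
    σ * v 0 t = σ * v 0 t₀ := by
  obtain ⟨B, hB, hb⟩ := h.exists_bound ha hκ
  obtain ⟨u, hu⟩ : ∃ u : ℕ → ℝ → ℝ, u = fun k t => σ * v k t := ⟨_, rfl⟩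
  have ju : IsJet 6 u := hu ▸ fun k hk t => (h.jet k hk t).const_mul σ
  have jz : IsJet 4 (helmholtz (a ^ 2) u) := ju.helmholtz _
  have jw : IsJet 2 (helmholtz ((a + 2) ^ 2) (helmholtz (a ^ 2) u)) := jz.helmholtz _
  have bu : ∀ k < 6, ∀ t, |u k t| ≤ |σ| * B := fun k hk t => by
    rw [hu, abs_mul]
    exact mul_le_mul_of_nonneg_left (hb k hk t) (abs_nonneg _)
  have bz : ∀ k < 4, ∀ t, |helmholtz (a ^ 2) u k t| ≤ a ^ 2 * (|σ| * B) + |σ| * B := by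
    intro k hk t
    refine (abs_sub _ _).trans (add_le_add ?_ (bu _ (by omega) t))
    rw [abs_mul, abs_of_nonneg (sq_nonneg a)]
    exact mul_le_mul_of_nonneg_left (bu _ (by omega) t) (sq_nonneg a)
  have bw : ∀ t, helmholtz ((a + 2) ^ 2) (helmholtz (a ^ 2) u) 0 t
      ≤ (a + 2) ^ 2 * (a ^ 2 * (|σ| * B) + |σ| * B) + (a ^ 2 * (|σ| * B) + |σ| * B) := by
    intro t
    refine (le_abs_self _).trans ((abs_sub _ _).trans (add_le_add ?_ (bz _ (by omega) t)))
    rw [abs_mul, abs_of_nonneg (sq_nonneg _)]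
    exact mul_le_mul_of_nonneg_left (bz _ (by omega) t) (sq_nonneg _)
  have hw := le_of_helmholtz_le (l := a + 4) (A := (a + 2) ^ 2 * (a ^ 2 * (σ * v 0 t₀)))
    (by linarith) jw bw fun t => by
      refine le_trans (le_of_eq ?_) (hode t)
      rw [← h.ode t, hu]
      simp only [helmholtz, Nat.reduceAdd]
      ring
  have hz := le_of_helmholtz_le (l := a + 2) (A := a ^ 2 * (σ * v 0 t₀)) (by linarith)
    (jz.mono (by norm_num)) (fun t => (le_abs_self _).trans (bz 0 (by norm_num) t)) hw
  have := eq_zero_of_nonneg_of_eq_zero (t₀ := t₀) ha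
    ((isJet_const 2 (σ * v 0 t₀)).sub (ju.mono (by norm_num))) (fun t => by simpa [hu] using hext t)
    (fun t => by
      have := hz t
      simp only [helmholtz, zero_add] at this
      simp only [helmholtz, if_true, OfNat.ofNat_ne_zero, if_false, zero_add]
      linarith) (by simp [hu]) t
  simp only [hu, if_true] at this
  linarith

lemma lt_of_isLocalMax (ha : 0 < a) (hκ : 0 < κ) (h : IsPosSol a κ v)
    (hnc : ¬∃ c, ∀ t, v 0 t = c) {t₀ : ℝ} (hmax : IsLocalMax (v 0) t₀) :
    a ^ 2 * (a + 2) ^ 2 * (a + 4) ^ 2 * v 0 t₀ < κ * v 0 t₀ ^ (1 + 6 / a) := by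
  by_contra! hle
  have hglob := le_of_isLocalMax_of_symmetric (h.jet 0 (by norm_num))
    (fun s hs t => h.symmetric ha hκ hs t) hmax
  refine hnc ⟨v 0 t₀, fun t => ?_⟩
  have := h.eq_of_extremum (σ := 1) (t₀ := t₀) ha hκ (fun t => by linarith [hglob t])
    (fun t => by
      have := mul_le_mul_of_nonneg_left (rpow_le_rpow (h.pos t).le (hglob t)
        (by positivity : 0 ≤ 1 + 6 / a)) hκ.le
      linarith) t
  linarith

lemma lt_of_isLocalMin (ha : 0 < a) (hκ : 0 < κ) (h : IsPosSol a κ v)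
    (hnc : ¬∃ c, ∀ t, v 0 t = c) {t₀ : ℝ} (hmin : IsLocalMin (v 0) t₀) :
    κ * v 0 t₀ ^ (1 + 6 / a) < a ^ 2 * (a + 2) ^ 2 * (a + 4) ^ 2 * v 0 t₀ := by
  by_contra! hle
  have hglob := le_of_isLocalMax_of_symmetric (fun t => (h.jet 0 (by norm_num) t).neg)
    (fun s hs t => by
      simpa using h.symmetric ha hκ (neg_eq_zero.1 hs) t) hmin.neg
  refine hnc ⟨v 0 t₀, fun t => ?_⟩
  have := h.eq_of_extremum (σ := -1) (t₀ := t₀) ha hκ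
    (fun t => by have := hglob t; simp at this; linarith)
    (fun t => by
      have h1 := hglob t
      simp only [Pi.neg_apply, neg_le_neg_iff] at h1
      have := mul_le_mul_of_nonneg_left (rpow_le_rpow (h.pos t₀).le h1
        (by positivity : 0 ≤ 1 + 6 / a)) hκ.le
      linarith) t
  linarith

end IsPosSol

lemma cN_pos {n : ℕ} (hn : 7 ≤ n) : 0 < cN n := by
  have h : (7 : ℝ) ≤ n := by exact_mod_cast hn
  have e : cN n = n * (n - 6) * ((n ^ 2 - 4) * (n ^ 2 - 16)) / 64 := by
    rw [cN]; ring
  have h1 : (0 : ℝ) < n - 6 := by linarith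
  have h2 : (0 : ℝ) < n ^ 2 - 4 := by nlinarith
  have h3 : (0 : ℝ) < n ^ 2 - 16 := by nlinarith
  have h4 : (0 : ℝ) < n := by linarith
  rw [e]
  positivity

lemma K0_pos {n : ℕ} (hn : 7 ≤ n) : 0 < K0 n := by
  have h : (7 : ℝ) ≤ n := by exact_mod_cast hn
  have h1 : (0 : ℝ) < n - 6 := by linarith
  have h2 : (0 : ℝ) < n - 2 := by linarith
  rw [K0]
  positivity

lemma IsSolO6.isPosSol {n : ℕ} (hn : 7 ≤ n) {v : ℝ → ℝ} (hv : IsSolO6 n v) (hpos : ∀ t, 0 < v t) :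
    IsPosSol (((n : ℝ) - 6) / 2) (cN n) (fun k => iteratedDeriv k v) where
  jet := by
    intro k hk t
    have hd : Differentiable ℝ (iteratedDeriv k v) :=
      hv.1.differentiable_iteratedDeriv k (by exact_mod_cast hk)
    simpa [iteratedDeriv_succ] using (hd t).hasDerivAt
  pos t := by simpa using hpos t
  ode t := by
    have h7 : (7 : ℝ) ≤ n := by exact_mod_cast hn
    have h := hv.2 t
    have e : (12 : ℝ) / (n - 6) = 6 / ((n - 6) / 2) := by
      have : (n : ℝ) - 6 ≠ 0 := by linarith
      field_simp
      norm_num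
    rw [abs_of_pos (hpos t), e] at h
    simp only [iteratedDeriv_zero, rpow_add (hpos t), rpow_one, helmholtz, Nat.reduceAdd]
    rw [K0, K2, K4] at h
    linarith

lemma lt_iff_aStar {n : ℕ} (hn : 7 ≤ n) {x : ℝ} (hx : 0 < x) :
    (aStar n < x ↔ K0 n * x < cN n * x ^ (1 + 6 / (((n : ℝ) - 6) / 2))) ∧
    (x < aStar n ↔ cN n * x ^ (1 + 6 / (((n : ℝ) - 6) / 2)) < K0 n * x) := by
  have h7 : (7 : ℝ) ≤ n := by exact_mod_cast hn
  have hn6 : (0 : ℝ) < n - 6 := by linarith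
  have hc := cN_pos hn
  have hq : 0 < K0 n / cN n := div_pos (K0_pos hn) hc
  obtain ⟨θ, hθ⟩ : ∃ θ : ℝ, θ = 6 / ((n - 6) / 2) := ⟨_, rfl⟩
  have hθ0 : 0 < θ := by rw [hθ]; positivity
  have hA : 0 < aStar n := rpow_pos_of_pos hq _
  have hAθ : aStar n ^ θ = K0 n / cN n := by
    rw [aStar, ← rpow_mul hq.le, hθ]
    have : ((n : ℝ) - 6) / 12 * (6 / ((n - 6) / 2)) = 1 := by field_simp; norm_num
    rw [this, rpow_one]
  have e : cN n * x ^ (1 + θ) = cN n * x ^ θ * x := by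
    rw [rpow_add hx, rpow_one]; ring
  rw [← hθ, e, mul_lt_mul_iff_left₀ hx, mul_lt_mul_iff_left₀ hx,
    ← rpow_lt_rpow_iff hA.le hx.le hθ0, ← rpow_lt_rpow_iff hx.le hA.le hθ0, hAθ,
    div_lt_iff₀ hc, lt_div_iff₀ hc, mul_comm (cN n)]
  exact ⟨Iff.rfl, Iff.rfl⟩

theorem local_extrema_of_positive_nonconstant_solutions
    (n : ℕ) (hn : 7 ≤ n) (v : ℝ → ℝ) (hv : IsSolO6 n v)
    (hpos : ∀ t : ℝ, 0 < v t) (hnc : ¬ ∃ c : ℝ, ∀ t : ℝ, v t = c) (t₀ : ℝ) :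
    (IsLocalMax v t₀ → aStar n < v t₀) ∧ (IsLocalMin v t₀ → v t₀ < aStar n) := by
  have h := hv.isPosSol hn hpos
  have h7 : (7 : ℝ) ≤ n := by exact_mod_cast hn
  have ha : 0 < ((n : ℝ) - 6) / 2 := by linarith
  have e0 : iteratedDeriv 0 v = v := iteratedDeriv_zero
  have eK : (((n : ℝ) - 6) / 2) ^ 2 * (((n : ℝ) - 6) / 2 + 2) ^ 2 * (((n : ℝ) - 6) / 2 + 4) ^ 2
      = K0 n := by
    rw [K0]; ring
  have hcmp := lt_iff_aStar hn (hpos t₀)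
  refine ⟨fun hmax => hcmp.1.2 ?_, fun hmin => hcmp.2.2 ?_⟩
  · have := h.lt_of_isLocalMax ha (cN_pos hn) (by rwa [e0]) (by rwa [e0])
    rwa [e0, eK] at this
  · have := h.lt_of_isLocalMin ha (cN_pos hn) (by rwa [e0]) (by rwa [e0])
    rwa [e0, eK] at this
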